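/- arXiv:2407.14619 — 9 statements merged into one kernel-verified Lean document; each statement's English description precedes it below -/
import Mathlib

section
/- Let C : ℝ → ℝ be continuous, suppose there exist p > 0 and c ∈ ℝ such that C(φ + p) = C(φ) + c for every φ ∈ ℝ, and assume C is not affine. Then there exists a positive constant H such that for every h > 0 there are δ ∈ (0, h] and φ ∈ [0, p) for which D²_δ C(φ) ≥ H, i.e. C(φ + 2δ) − 2 C(φ + δ) + C(φ) ≥ H δ². -/
/-- A quadratic upper bound on the second differences of small step extends to all steps,
because second differences of step `2 * δ` are combinations of those of step `δ`. -/
theorem second_difference_le_of_small_steps {C : ℝ → ℝ} {H h : ℝ} (hh : 0 < h)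
    (hsmall : ∀ δ ∈ Set.Ioc (0 : ℝ) h, ∀ x, C (x + 2 * δ) - 2 * C (x + δ) + C x ≤ H * δ ^ 2)
    {δ : ℝ} (hδ : 0 < δ) (x : ℝ) : C (x + 2 * δ) - 2 * C (x + δ) + C x ≤ H * δ ^ 2 := by
  have hpow : ∀ n : ℕ, ∀ δ : ℝ, 0 < δ → δ ≤ 2 ^ n * h → ∀ x,
      C (x + 2 * δ) - 2 * C (x + δ) + C x ≤ H * δ ^ 2 := by
    intro n
    induction n with
    | zero => exact fun δ h0 h1 x => hsmall δ ⟨h0, by simpa using h1⟩ x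
    | succ n ih =>
      intro δ h0 h1 x
      have ih' := ih (δ / 2) (by positivity) (by rw [pow_succ] at h1; linarith)
      have e1 := ih' x
      have e2 := ih' (x + δ / 2)
      have e3 := ih' (x + δ)
      rw [show x + 2 * (δ / 2) = x + δ by ring] at e1
      rw [show x + δ / 2 + 2 * (δ / 2) = x + δ + δ / 2 by ring,
        show x + δ / 2 + δ / 2 = x + δ by ring] at e2
      rw [show x + δ + 2 * (δ / 2) = x + 2 * δ by ring] at e3
      linarith
  obtain ⟨n, hn⟩ := pow_unbounded_of_one_lt (δ / h) (one_lt_two : (1 : ℝ) < 2)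
  exact hpow n δ hδ ((div_lt_iff₀ hh).1 hn).le x

/-- A continuous periodic real function attains its minimum. -/
theorem Function.Periodic.exists_forall_le_of_continuous {g : ℝ → ℝ} {p : ℝ}
    (hg : Function.Periodic g p) (hp : 0 < p) (hcont : Continuous g) :
    ∃ m, ∀ x, g m ≤ g x := by
  obtain ⟨m, -, hm⟩ := isCompact_Icc.exists_isMinOn (Set.nonempty_Icc.2 hp.le) hcont.continuousOn
  refine ⟨m, fun x => ?_⟩
  obtain ⟨y, hy, hxy⟩ := hg.exists_mem_Ico₀ hp x
  exact hxy ▸ hm (Set.Ico_subset_Icc_self hy)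

/-- Lemma 3.3 of the paper. Let `C : ℝ → ℝ` be continuous and quasi-periodic,
i.e. `C (φ + p) = C φ + c` for some `p > 0`, and not affine. Then there is `H > 0` such that
for every `h > 0` there are `δ ∈ (0, h]` and `φ ∈ [0, p)` with
`D²_δ C(φ) ≥ H`, i.e. `C (φ + 2δ) − 2 C (φ + δ) + C φ ≥ H δ²`. -/
theorem exists_second_difference_lower_bound (C : ℝ → ℝ) (hC : Continuous C)
    (p c : ℝ) (hp : 0 < p) (hqp : ∀ φ : ℝ, C (φ + p) = C φ + c)
    (hnotaff : ¬ ∃ a b : ℝ, ∀ x : ℝ, C x = a * x + b) :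
    ∃ H > (0 : ℝ), ∀ h > (0 : ℝ), ∃ δ ∈ Set.Ioc (0 : ℝ) h, ∃ φ ∈ Set.Ico (0 : ℝ) p,
      C (φ + 2 * δ) - 2 * C (φ + δ) + C φ ≥ H * δ ^ 2 := by
  obtain ⟨g, hg⟩ : ∃ g : ℝ → ℝ, ∀ x, g x = C x - c / p * x := ⟨_, fun _ => rfl⟩
  have hper : Function.Periodic g p := fun x => by
    rw [hg, hg, hqp]
    field_simp
    ring
  have hcont : Continuous g := by
    rw [funext hg]
    fun_prop
  obtain ⟨m, hm⟩ := hper.exists_forall_le_of_continuous hp hcont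
  obtain ⟨b, hb⟩ : ∃ b, g m < g b := by
    by_contra! hle
    refine hnotaff ⟨c / p, g m, fun x => ?_⟩
    linarith [hg x, hm x, hle x]
  have hne : b - m ≠ 0 := fun h0 => by
    rw [sub_eq_zero.1 h0] at hb
    exact hb.false
  refine ⟨(g b - g m) / (2 * (b - m) ^ 2), div_pos (by linarith) (by positivity), ?_⟩
  by_contra! hcon
  obtain ⟨h, hh, hcon⟩ := hcon
  set H := (g b - g m) / (2 * (b - m) ^ 2) with hH
  have hsmall : ∀ δ ∈ Set.Ioc (0 : ℝ) h, ∀ x,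
      g (x + 2 * δ) - 2 * g (x + δ) + g x ≤ H * δ ^ 2 := by
    intro δ hδ x
    have hdiff : Function.Periodic (fun x => g (x + 2 * δ) - 2 * g (x + δ) + g x) p := fun x => by
      beta_reduce
      rw [add_right_comm x p, add_right_comm x p δ, hper, hper, hper]
    obtain ⟨y, hy, hxy⟩ := hdiff.exists_mem_Ico₀ hp x
    rw [hxy, hg, hg, hg]
    linarith [hcon δ hδ y hy]
  have hlarge := second_difference_le_of_small_steps hh hsmall (abs_pos.2 hne) (m - |b - m|)
  rw [sq_abs, show H * (b - m) ^ 2 = (g b - g m) / 2 by rw [hH]; field_simp,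
    show m - |b - m| + 2 * |b - m| = m + |b - m| by ring, sub_add_cancel] at hlarge
  rcases abs_choice (b - m) with habs | habs <;> rw [habs] at hlarge
  · rw [show m + (b - m) = b by ring] at hlarge
    linarith [hm (m - (b - m))]
  · rw [show m - -(b - m) = b by ring] at hlarge
    linarith [hm (m + -(b - m))]
end

section
/- Let C : ℝ → ℝ be Lipschitz, suppose there exist p > 0 and c ∈ ℝ such that C(φ + p) = C(φ) + c for every φ ∈ ℝ, and assume C is not affine. Then there exists a positive constant H such that for every h > 0 there are δ ∈ (0, h], φ ∈ ℝ, ω ∈ (0, 2δ], and K ∈ ℝ with K ≥ essinf_{t ∈ [φ, φ+ω)} C′(t), for which Δ_t C(φ) ≤ (K + Hδ/2)·t for all t ∈ [0, ω], and Δ_ω C(φ) = (K + Hδ/2)·ω. -/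
open MeasureTheory

/-- The increment of a Lipschitz function over an initial part of an interval is at least the
essential infimum of the derivative over the interval times the length of that part. -/
lemma LipschitzWith.essInf_deriv_mul_le_sub {f : ℝ → ℝ} {L : NNReal} (hf : LipschitzWith L f)
    {a m b : ℝ} (ham : a ≤ m) (hmb : m ≤ b) :
    essInf (deriv f) (volume.restrict (Set.Ico a b)) * (m - a) ≤ f m - f a := by
  have hac : AbsolutelyContinuousOnInterval f a m :=
    (hf.lipschitzOnWith (s := Set.uIcc a m)).absolutelyContinuousOnInterval
  have hbdd : Filter.IsBoundedUnder (· ≥ ·) (ae (volume.restrict (Set.Ico a b))) (deriv f) :=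
    Filter.isBoundedUnder_of ⟨-L, fun x => (abs_le.mp (norm_deriv_le_of_lipschitz hf)).1⟩
  have hae : ∀ᵐ x ∂volume.restrict (Set.Icc a m),
      essInf (deriv f) (volume.restrict (Set.Ico a b)) ≤ deriv f x := by
    rw [← Measure.restrict_congr_set (Ico_ae_eq_Icc (μ := volume) (a := a) (b := m))]
    exact ae_mono (Measure.restrict_mono (Set.Ico_subset_Ico_right hmb) le_rfl)
      (ae_essInf_le hbdd)
  have hmono := intervalIntegral.integral_mono_ae_restrict ham intervalIntegrable_const
    hac.intervalIntegrable_deriv hae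
  rw [hac.integral_deriv_eq_sub, intervalIntegral.integral_const, smul_eq_mul] at hmono
  linarith

/-- A nonconstant continuous periodic function admits a point at which all sufficiently small
second differences are at least a positive multiple of the square of the step. -/
lemma Function.Periodic.exists_mul_sq_le_second_difference {f : ℝ → ℝ} (hf : Continuous f)
    {p : ℝ} (hp : 0 < p) (hper : Function.Periodic f p) {u v : ℝ} (huv : f u < f v) :
    ∃ η > 0, ∃ y, ∃ r > 0, ∀ s, 0 ≤ s → s ≤ r →
      η * s ^ 2 ≤ f (y + s) + f (y - s) - 2 * f y := by
  obtain ⟨w, ⟨huw, hwu⟩, hw⟩ := hper.exists_mem_Ico hp v u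
  rw [hw] at huv
  obtain ⟨η, hη⟩ : ∃ η, η = (f w - f u) / p ^ 2 := ⟨_, rfl⟩
  have hη0 : 0 < η := hη ▸ div_pos (sub_pos.mpr huv) (by positivity)
  have hηp : η * p ^ 2 = f w - f u := by rw [hη]; field_simp
  have hwp : f (w - p) = f w := hper.sub_eq w
  obtain ⟨y, ⟨hy1, hy2⟩, hmin⟩ := (isCompact_Icc (a := w - p) (b := w)).exists_isMinOn
    ⟨u, by constructor <;> linarith⟩
    (f := fun x => f x - η / 2 * (x - u) ^ 2) (by fun_prop)
  have hle : ∀ x, w - p ≤ x → x ≤ w →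
      f y - η / 2 * (y - u) ^ 2 ≤ f x - η / 2 * (x - u) ^ 2 := fun x h1 h2 => hmin ⟨h1, h2⟩
  have hyu := hle u (by linarith) huw
  have hne : f y ≠ f w := fun h => by
    have : (y - u) ^ 2 ≤ p ^ 2 := sq_le_sq' (by linarith) (by linarith)
    nlinarith
  have hy1' : w - p < y := lt_of_le_of_ne hy1 fun h => hne (h ▸ hwp)
  have hy2' : y < w := lt_of_le_of_ne hy2 fun h => hne (h ▸ rfl)
  refine ⟨η, hη0, y, min (y - (w - p)) (w - y), lt_min (by linarith) (by linarith), ?_⟩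
  intro s hs hsr
  obtain ⟨h1, h2⟩ := le_min_iff.mp hsr
  have hplus := hle (y + s) (by linarith) (by linarith)
  have hminus := hle (y - s) (by linarith) (by linarith)
  nlinarith

/-- The last zero of a continuous function before a point where it is negative. -/
lemma Continuous.exists_zero_nonpos_of_neg {g : ℝ → ℝ} (hg : Continuous g) {u y : ℝ}
    (huy : u ≤ y) (hu : g u = 0) (hy : g y < 0) :
    ∃ a, u ≤ a ∧ a < y ∧ g a = 0 ∧ ∀ t, a ≤ t → t ≤ y → g t ≤ 0 := by
  obtain ⟨a, ⟨⟨hua, hay⟩, ha⟩, hmax⟩ := (isCompact_Icc.inter_right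
    (isClosed_singleton.preimage hg)).exists_isGreatest
    (s := Set.Icc u y ∩ g ⁻¹' {0}) ⟨u, ⟨le_rfl, huy⟩, hu⟩
  rw [Set.mem_preimage, Set.mem_singleton_iff] at ha
  refine ⟨a, hua, lt_of_le_of_ne hay fun h => by rw [h] at ha; linarith, ha, ?_⟩
  intro t hat hty
  by_contra! ht
  obtain ⟨z, ⟨htz, hzy⟩, hz⟩ := intermediate_value_Icc' hty hg.continuousOn ⟨hy.le, ht.le⟩
  have hza : z ≤ a := hmax ⟨⟨by linarith, hzy⟩, hz⟩
  have : t = a := by linarith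
  rw [this] at ht
  linarith

open MeasureTheory

/-- Lemma 3.4 of the paper. Let `C : ℝ → ℝ` be Lipschitz, quasi-periodic
(`C (φ + p) = C φ + c`, `p > 0`) and not affine. Then there is `H > 0` such that for every
`h > 0` there are `δ ∈ (0, h]`, `φ ∈ ℝ`, `ω ∈ (0, 2δ]` and
`K ≥ essinf_{t ∈ [φ, φ+ω)} C′(t)` with
`Δ_t C(φ) ≤ (K + Hδ/2) t` for all `t ∈ [0, ω]`, and `Δ_ω C(φ) = (K + Hδ/2) ω`. -/
theorem exists_good_chord_upper_bound (C : ℝ → ℝ) (L : NNReal) (hC : LipschitzWith L C)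
    (p c : ℝ) (hp : 0 < p) (hqp : ∀ φ : ℝ, C (φ + p) = C φ + c)
    (hnotaff : ¬ ∃ a b : ℝ, ∀ x : ℝ, C x = a * x + b) :
    ∃ H > (0 : ℝ), ∀ h > (0 : ℝ), ∃ δ ∈ Set.Ioc (0 : ℝ) h, ∃ φ : ℝ,
      ∃ ω ∈ Set.Ioc (0 : ℝ) (2 * δ), ∃ K : ℝ,
        K ≥ essInf (deriv C) (volume.restrict (Set.Ico φ (φ + ω))) ∧
        (∀ t ∈ Set.Icc (0 : ℝ) ω, C (φ + t) - C φ ≤ (K + H * δ / 2) * t) ∧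
        C (φ + ω) - C φ = (K + H * δ / 2) * ω := by
  obtain ⟨f, hfdef⟩ : ∃ f : ℝ → ℝ, f = fun x => C x - c / p * x := ⟨_, rfl⟩
  have hfx : ∀ x, f x = C x - c / p * x := fun x => by rw [hfdef]
  have hCc : Continuous C := hC.continuous
  have hper : Function.Periodic f p := fun x => by
    rw [hfx, hfx, hqp]
    field_simp
    ring
  obtain ⟨u, v, huv⟩ : ∃ u v, f u < f v := by
    by_contra! hle
    refine hnotaff ⟨c / p, f 0, fun x => ?_⟩
    linarith [hle x 0, hle 0 x, hfx x]
  obtain ⟨η, hη, y, r, hr, hsecond⟩ :=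
    hper.exists_mul_sq_le_second_difference (by rw [hfdef]; fun_prop) hp huv
  refine ⟨η, hη, fun h hh => ?_⟩
  obtain ⟨s, hs, hsh, hsr⟩ : ∃ s > 0, s ≤ h ∧ s ≤ r :=
    ⟨min h r, lt_min hh hr, min_le_left _ _, min_le_right _ _⟩
  have hsec := hsecond s hs.le hsr
  simp only [hfx] at hsec
  obtain ⟨A, hA⟩ : ∃ A, A = (C (y + s) - C (y - s)) / (2 * s) := ⟨_, rfl⟩
  have hAs : A * (2 * s) = C (y + s) - C (y - s) := by rw [hA]; field_simp
  obtain ⟨g, hgdef⟩ : ∃ g : ℝ → ℝ, g = fun x => C x - C (y - s) - A * (x - (y - s)) := ⟨_, rfl⟩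
  have hgx : ∀ x, g x = C x - C (y - s) - A * (x - (y - s)) := fun x => by rw [hgdef]
  have hg : Continuous g := by rw [hgdef]; fun_prop
  have hgy : g y ≤ -(η * s ^ 2 / 2) := by rw [hgx]; linarith
  have hgy0 : g y < 0 := hgy.trans_lt (by simp only [neg_lt_zero]; positivity)
  obtain ⟨a, hua, hay, hga, hgleft⟩ := hg.exists_zero_nonpos_of_neg (u := y - s) (y := y)
    (by linarith) (by rw [hgx]; ring) hgy0
  obtain ⟨b, hub, hby, hgb, hgright⟩ := (hg.comp continuous_neg).exists_zero_nonpos_of_neg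
    (u := -(y + s)) (y := -y) (by linarith)
    (by simp only [Function.comp_apply, neg_neg, hgx]; linarith)
    (by simpa using hgy0)
  simp only [Function.comp_apply] at hgb hgright
  have hnonpos : ∀ x, a ≤ x → x ≤ -b → g x ≤ 0 := fun x hax hxb => by
    rcases le_total x y with hxy | hxy
    · exact hgleft x hax hxy
    · simpa using hgright (-x) (by linarith) (by linarith)
  refine ⟨s, ⟨hs, hsh⟩, a, -b - a, ⟨by linarith, by linarith⟩, A - η * s / 2, ?_, ?_, ?_⟩
  · have hess := hC.essInf_deriv_mul_le_sub (b := a + (-b - a)) hay.le (by linarith)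
    have hpos : 0 < y - a := by linarith
    refine le_of_mul_le_mul_right (hess.trans ?_) hpos
    rw [hgx] at hga hgy
    nlinarith [mul_nonneg (mul_pos hη hs).le (show 0 ≤ s - (y - a) by linarith)]
  · rintro t ⟨ht0, ht⟩
    have := hnonpos (a + t) (by linarith) (by linarith)
    rw [hgx] at this hga
    linarith
  · rw [hgx] at hga hgb
    rw [show a + (-b - a) = -b by ring]
    linarith
end

section
/- Let C : ℝ → ℝ be Lipschitz, suppose there exist p > 0 and c ∈ ℝ such that C(φ + p) = C(φ) + c for every φ ∈ ℝ, and assume C is not affine. For A′ ∈ ℝ set S_{A′} := {ψ ∈ ℝ : C is differentiable at ψ and C′(ψ) ≤ A′}. Then there exists a positive constant H such that for every h > 0 there are δ ∈ (0, h] and A ≥ essinf_{t ∈ ℝ} C′(t) satisfying: for all sufficiently small ε > 0, there are a Lebesgue density point φ of S_{A+ε}, ω ∈ (0, 2δ], and B ≥ Hδ/2 for which A·t ≤ Δ_t C(φ) ≤ (A + B)·t for all t ∈ [0, ω], and Δ_ω C(φ) = (A + B)·ω. -/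
open MeasureTheory

/-- `φ` is a Lebesgue density point of a set `S ⊆ ℝ`:
`ℒ¹(S ∩ [φ − ρ, φ + ρ])/(2ρ) → 1` as `ρ → 0⁺`. -/
def IsDensityPoint (S : Set ℝ) (φ : ℝ) : Prop :=
  Filter.Tendsto
    (fun ρ : ℝ => volume (S ∩ Set.Icc (φ - ρ) (φ + ρ)) / ENNReal.ofReal (2 * ρ))
    (nhdsWithin 0 (Set.Ioi 0)) (nhds 1)

/-- Almost every point of a set is a density point of it. -/
theorem ae_restrict_isDensityPoint (S : Set ℝ) :
    ∀ᵐ x ∂volume.restrict S, IsDensityPoint S x := by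
  filter_upwards [Besicovitch.ae_tendsto_measure_inter_div volume S] with x hx
  simp only [Real.volume_closedBall] at hx
  simpa only [IsDensityPoint, Real.closedBall_eq_Icc] using hx

/-- Every subset of positive measure contains a density point of the ambient set. -/
theorem exists_mem_isDensityPoint {S T : Set ℝ} (hTS : T ⊆ S) (hT : volume T ≠ 0) :
    ∃ x ∈ T, IsDensityPoint S x := by
  by_contra! hcon
  have h := ae_restrict_isDensityPoint S
  rw [ae_iff] at h
  have hsub : T ⊆ {x | ¬IsDensityPoint S x} ∩ S := fun x hx => ⟨hcon x hx, hTS hx⟩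
  exact hT (measure_mono_null hsub
    (nonpos_iff_eq_zero.mp ((Measure.le_restrict_apply _ _).trans h.le)))

namespace LipschitzWith

variable {C : ℝ → ℝ} {L : NNReal}

theorem neg_le_deriv (hC : LipschitzWith L C) (x : ℝ) : -(L : ℝ) ≤ deriv C x :=
  (abs_le.mp (norm_deriv_le_of_lipschitz (x₀ := x) hC)).1

theorem deriv_le (hC : LipschitzWith L C) (x : ℝ) : deriv C x ≤ L :=
  (abs_le.mp (norm_deriv_le_of_lipschitz (x₀ := x) hC)).2

theorem isBoundedUnder_ge_deriv (hC : LipschitzWith L C) (l : Filter ℝ) :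
    l.IsBoundedUnder (· ≥ ·) (deriv C) :=
  Filter.isBoundedUnder_of ⟨-L, hC.neg_le_deriv⟩

theorem isCoboundedUnder_ge_deriv (hC : LipschitzWith L C) (l : Filter ℝ) [l.NeBot] :
    l.IsCoboundedUnder (· ≥ ·) (deriv C) :=
  Filter.IsBoundedUnder.isCoboundedUnder_ge (Filter.isBoundedUnder_of ⟨L, hC.deriv_le⟩)

/-- A lower bound for the derivative almost everywhere on an interval bounds increments. -/
theorem mul_sub_le_sub_of_ae_le_deriv (hC : LipschitzWith L C) {A a b : ℝ} (hab : a ≤ b)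
    (hA : ∀ᵐ x ∂volume.restrict (Set.Icc a b), A ≤ deriv C x) :
    A * (b - a) ≤ C b - C a := by
  have hac : AbsolutelyContinuousOnInterval C a b :=
    (hC.lipschitzOnWith (s := Set.uIcc a b)).absolutelyContinuousOnInterval
  rw [← hac.integral_deriv_eq_sub]
  calc A * (b - a) = ∫ _ in a..b, A := by simp [mul_comm]
    _ ≤ ∫ x in a..b, deriv C x :=
      intervalIntegral.integral_mono_ae_restrict hab intervalIntegrable_const
        hac.intervalIntegrable_deriv hA

/-- There are points of `[a, b]` at which `C` is differentiable with derivative less than `A'`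
and which are density points of `{C' ≤ A'}`, as soon as `A'` exceeds the essential infimum of
`C'` on `[a, b]`. -/
theorem exists_isDensityPoint_of_essInf_lt (hC : LipschitzWith L C) {a b A' : ℝ} (hab : a < b)
    (hA' : essInf (deriv C) (volume.restrict (Set.Icc a b)) < A') :
    ∃ x ∈ Set.Icc a b, DifferentiableAt ℝ C x ∧ deriv C x ≤ A' ∧
      IsDensityPoint {ψ : ℝ | DifferentiableAt ℝ C ψ ∧ deriv C ψ ≤ A'} x := by
  have : NeZero (volume.restrict (Set.Icc a b)) :=
    ⟨by simp [Measure.restrict_eq_zero, hab]⟩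
  set S := {ψ : ℝ | DifferentiableAt ℝ C ψ ∧ deriv C ψ ≤ A'} with hS
  have hpos : volume (S ∩ Set.Icc a b) ≠ 0 := by
    intro h0
    refine hA'.not_ge (le_essInf_of_ae_le A' ?_ (hC.isCoboundedUnder_ge_deriv _))
    have h1 : ∀ᵐ x ∂volume.restrict (Set.Icc a b), x ∉ S := by
      rw [ae_restrict_iff' measurableSet_Icc]
      filter_upwards [measure_eq_zero_iff_ae_notMem.mp h0] with x hx hxI hxS
      exact hx ⟨hxS, hxI⟩
    filter_upwards [h1, ae_restrict_of_ae hC.ae_differentiableAt_real] with x hx hd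
    exact (not_le.mp fun h => hx ⟨hd, h⟩).le
  obtain ⟨x, hx, hxd⟩ := exists_mem_isDensityPoint Set.inter_subset_left hpos
  exact ⟨x, hx.2, hx.1.1, hx.1.2, hxd⟩

end LipschitzWith

/-- If the slope of the chord over `[a, b]` exceeds the derivative at `a`, then some chord
starting at `a` has maximal slope. -/
theorem exists_chord_slope_max {f : ℝ → ℝ} {a b : ℝ} (hf : ContinuousOn f (Set.Icc a b))
    (hd : DifferentiableAt ℝ f a) (hab : a < b) (hlt : deriv f a < slope f a b) :
    ∃ y ∈ Set.Ioc a b, slope f a b ≤ slope f a y ∧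
      ∀ x ∈ Set.Ioc a b, slope f a x ≤ slope f a y := by
  have hcont : ContinuousOn (dslope f a) (Set.Icc a b) := by
    intro x hx
    rcases eq_or_ne x a with rfl | hne
    · exact (continuousAt_dslope_same.2 hd).continuousWithinAt
    · exact (continuousWithinAt_dslope_of_ne hne).2 (hf x hx)
  obtain ⟨y, hy, hmax⟩ := isCompact_Icc.exists_isMaxOn (Set.nonempty_Icc.2 hab.le) hcont
  have hb : slope f a b ≤ dslope f a y := by
    rw [← dslope_of_ne f hab.ne']
    exact hmax (Set.right_mem_Icc.2 hab.le)
  have hya : y ≠ a := by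
    rintro rfl
    rw [dslope_same] at hb
    exact hb.not_gt hlt
  rw [dslope_of_ne f hya] at hb
  refine ⟨y, ⟨lt_of_le_of_ne hy.1 hya.symm, hy.2⟩, hb, fun x hx => ?_⟩
  rw [← dslope_of_ne f hya, ← dslope_of_ne f hx.1.ne']
  exact hmax (Set.Ioc_subset_Icc_self hx)

/-- A continuous non-affine function which is periodic up to a constant is touched from below,
locally, by a strictly convex parabola. -/
theorem exists_parabola_touching_below {C : ℝ → ℝ} (hC : Continuous C) {p c : ℝ} (hp : 0 < p)
    (hqp : ∀ φ : ℝ, C (φ + p) = C φ + c)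
    (hnotaff : ¬ ∃ a b : ℝ, ∀ x : ℝ, C x = a * x + b) :
    ∃ H > (0 : ℝ), ∃ r > (0 : ℝ), ∃ x₀ κ : ℝ, ∀ y ∈ Set.Icc (x₀ - r) (x₀ + r),
      C x₀ + κ * (y - x₀) + H * (y - x₀) ^ 2 ≤ C y := by
  set g : ℝ → ℝ := fun x => C x - c / p * x with hg
  have hgc : Continuous g := by fun_prop
  have hper : Function.Periodic g p := fun x => by
    simp only [hg, hqp]
    field_simp
    ring
  obtain ⟨a, -, ha⟩ := (isCompact_Icc (a := (0 : ℝ)) (b := p)).exists_isMaxOn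
    (Set.nonempty_Icc.2 hp.le) hgc.continuousOn
  have hmax : ∀ x, g x ≤ g a := fun x => by
    obtain ⟨y, hy, hxy⟩ := hper.exists_mem_Ico₀ hp x
    rw [hxy]
    exact ha (Set.Ico_subset_Icc_self hy)
  obtain ⟨m, hm, hlt⟩ : ∃ m ∈ Set.Ico a (a + p), g m < g a := by
    by_contra! hcon
    refine hnotaff ⟨c / p, g a, fun x => ?_⟩
    obtain ⟨y, hy, hxy⟩ := hper.exists_mem_Ico hp x a
    have h1 := hcon y hy
    have h2 := hmax x
    have h3 : g x = C x - c / p * x := rfl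
    linarith
  set H : ℝ := 2 * (g a - g m) / p ^ 2 with hH
  have hH0 : 0 < H := by have := sub_pos.2 hlt; positivity
  have hHp : H * (p / 2) ^ 2 = (g a - g m) / 2 := by rw [hH]; field_simp
  set F : ℝ → ℝ := fun x => g x - H * (x - (a + p / 2)) ^ 2 with hF
  obtain ⟨x₀, hx₀, hmin⟩ := (isCompact_Icc (a := a) (b := a + p)).exists_isMinOn
    (Set.nonempty_Icc.2 (by linarith)) (show Continuous F by fun_prop).continuousOn
  have hFm : F x₀ ≤ g m :=
    (hmin (Set.Ico_subset_Icc_self hm)).trans (sub_le_self _ (by positivity))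
  have hFa : F a = g a - (g a - g m) / 2 := by rw [← hHp]; simp only [hF]; ring
  have hFap : F (a + p) = g a - (g a - g m) / 2 := by
    rw [← hHp]; simp only [hF, hper a]; ring
  have hx₀a : a < x₀ := lt_of_le_of_ne hx₀.1 (by rintro rfl; linarith)
  have hx₀b : x₀ < a + p := lt_of_le_of_ne hx₀.2 (by rintro h; rw [h] at hFm; linarith)
  refine ⟨H, hH0, min (x₀ - a) (a + p - x₀), lt_min (by linarith) (by linarith), x₀,
    c / p + 2 * H * (x₀ - (a + p / 2)), fun y hy => ?_⟩
  have h1 := min_le_left (x₀ - a) (a + p - x₀)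
  have h2 := min_le_right (x₀ - a) (a + p - x₀)
  have hFy : F x₀ ≤ F y := hmin ⟨by linarith [hy.1], by linarith [hy.2]⟩
  simp only [hF, hg] at hFy
  linarith

/-- Lemma 3.5 of the paper. Let `C : ℝ → ℝ` be Lipschitz, quasi-periodic
(`C (φ + p) = C φ + c`, `p > 0`) and not affine. With
`S_{A′} = {ψ : C differentiable at ψ and C′(ψ) ≤ A′}`, there is `H > 0` such that for every
`h > 0` there are `δ ∈ (0, h]` and `A ≥ essinf C′` such that for all sufficiently small
`ε > 0` there are a density point `φ` of `S_{A+ε}`, `ω ∈ (0, 2δ]` and `B ≥ Hδ/2` with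
`A t ≤ Δ_t C(φ) ≤ (A + B) t` for all `t ∈ [0, ω]`, and `Δ_ω C(φ) = (A + B) ω`. -/
theorem exists_good_chord_two_sided_bound (C : ℝ → ℝ) (L : NNReal) (hC : LipschitzWith L C)
    (p c : ℝ) (hp : 0 < p) (hqp : ∀ φ : ℝ, C (φ + p) = C φ + c)
    (hnotaff : ¬ ∃ a b : ℝ, ∀ x : ℝ, C x = a * x + b) :
    ∃ H > (0 : ℝ), ∀ h > (0 : ℝ), ∃ δ ∈ Set.Ioc (0 : ℝ) h, ∃ A : ℝ,
      A ≥ essInf (deriv C) volume ∧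
      ∃ ε₀ > (0 : ℝ), ∀ ε ∈ Set.Ioo (0 : ℝ) ε₀,
        ∃ φ : ℝ,
          IsDensityPoint {ψ : ℝ | DifferentiableAt ℝ C ψ ∧ deriv C ψ ≤ A + ε} φ ∧
          ∃ ω ∈ Set.Ioc (0 : ℝ) (2 * δ), ∃ B : ℝ, B ≥ H * δ / 2 ∧
            (∀ t ∈ Set.Icc (0 : ℝ) ω,
              A * t ≤ C (φ + t) - C φ ∧ C (φ + t) - C φ ≤ (A + B) * t) ∧
            C (φ + ω) - C φ = (A + B) * ω := by
  obtain ⟨H, hH, r, hr, x₀, κ, htouch⟩ :=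
    exists_parabola_touching_below hC.continuous hp hqp hnotaff
  refine ⟨H, hH, fun h hh => ?_⟩
  set δ := min h r with hδ
  have hδ0 : 0 < δ := lt_min hh hr
  have hδr : δ ≤ r := min_le_right _ _
  set μ := volume.restrict (Set.Icc (x₀ - δ) x₀) with hμ
  have : NeZero μ := ⟨by simp [hμ, Measure.restrict_eq_zero, hδ0]⟩
  set A := essInf (deriv C) μ with hA
  have hAe : ∀ᵐ x ∂μ, A ≤ deriv C x := ae_essInf_le (hC.isBoundedUnder_ge_deriv _)
  have hAκ : A ≤ κ - H * δ := by
    have h1 := hC.mul_sub_le_sub_of_ae_le_deriv (by linarith) hAe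
    have h2 := htouch (x₀ - δ) ⟨by linarith, by linarith⟩
    have h3 : A * δ ≤ (κ - H * δ) * δ := by linarith
    exact le_of_mul_le_mul_right h3 hδ0
  refine ⟨δ, ⟨hδ0, min_le_left _ _⟩, A, ?_, H * δ / 2, by positivity, fun ε hε => ?_⟩
  · exact essInf_antitone_measure Measure.restrict_le_self.absolutelyContinuous
      (hC.isBoundedUnder_ge_deriv _) (hC.isCoboundedUnder_ge_deriv _)
  obtain ⟨φ, hφ, hd, hdφ, hdens⟩ := hC.exists_isDensityPoint_of_essInf_lt
    (a := x₀ - δ) (b := x₀) (A' := A + ε) (by linarith) (by linarith [hε.1])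
  have hleft : ∀ y ∈ Set.Icc φ x₀, A * (y - φ) ≤ C y - C φ := fun y hy =>
    hC.mul_sub_le_sub_of_ae_le_deriv hy.1
      (ae_restrict_of_ae_restrict_of_subset (Set.Icc_subset_Icc hφ.1 hy.2) hAe)
  have hx₀ := hleft x₀ ⟨hφ.2, le_rfl⟩
  have hright : ∀ y ∈ Set.Icc x₀ (x₀ + δ),
      A * (y - φ) + H * δ * (y - x₀) ≤ C y - C φ := fun y hy => by
    have h1 := htouch y ⟨by linarith [hy.1], by linarith [hy.2]⟩
    have h2 := mul_le_mul_of_nonneg_right hAκ (sub_nonneg.2 hy.1)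
    have h3 : 0 ≤ H * (y - x₀) ^ 2 := by positivity
    linarith
  have hlower : ∀ y ∈ Set.Icc φ (x₀ + δ), A * (y - φ) ≤ C y - C φ := fun y hy => by
    rcases le_total y x₀ with hyx | hyx
    · exact hleft y ⟨hy.1, hyx⟩
    · have h1 := hright y ⟨hyx, hy.2⟩
      have h2 : 0 ≤ H * δ * (y - x₀) := mul_nonneg (by positivity) (by linarith)
      linarith
  have hφb : φ < x₀ + δ := by linarith [hφ.2]
  have hgrow : A + H * δ / 2 ≤ slope C φ (x₀ + δ) := by
    rw [slope_def_field, le_div_iff₀ (by linarith)]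
    have h1 := hright (x₀ + δ) ⟨by linarith, le_rfl⟩
    have h2 : H * δ * (x₀ + δ - φ) ≤ H * δ * (2 * δ) :=
      mul_le_mul_of_nonneg_left (by linarith [hφ.1]) (by positivity)
    linarith
  obtain ⟨y, hy, hby, hmax⟩ := exists_chord_slope_max hC.continuous.continuousOn hd hφb
    (by linarith [hε.2])
  refine ⟨φ, hdens, y - φ, ⟨by linarith [hy.1], by linarith [hy.2, hφ.1]⟩, slope C φ y - A,
    by linarith, fun t ht => ⟨?_, ?_⟩, ?_⟩
  · have h1 := hlower (φ + t) ⟨by linarith [ht.1], by linarith [ht.2, hy.2]⟩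
    rwa [add_sub_cancel_left] at h1
  · rcases ht.1.eq_or_lt with rfl | ht0
    · simp
    · have h1 := hmax (φ + t) ⟨by linarith, by linarith [ht.2, hy.2]⟩
      rw [slope_def_field, add_sub_cancel_left, div_le_iff₀ ht0] at h1
      rwa [add_sub_cancel]
  · rw [add_sub_cancel, add_sub_cancel, slope_def_field, div_mul_cancel₀ _ (sub_pos.2 hy.1).ne']
end

section
/- Let C : ℝ → ℝ be Lipschitz. For all φ ∈ ℝ and ω ∈ ℝ it holds that P(φ, ω) = 2 Δ_ω C(φ) · ∫₀^ω (ω − t) Δ_t C(φ) dt − ( ∫₀^ω Δ_t C(φ) dt )², where Δ_t C(φ) := C(φ + t) − C(φ) and the integrals are oriented (interval) integrals. -/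
open intervalIntegral

/-- `P(φ, ω) = (1/2) ∫_φ^{φ+ω} ∫_φ^{φ+ω} (t − s)² C′(t) C′(s) ds dt`, with oriented
(interval) Lebesgue integrals of the a.e.-defined derivative of the Lipschitz map `C`. -/
noncomputable def Pfun (C : ℝ → ℝ) (φ ω : ℝ) : ℝ :=
  (1 / 2) * ∫ t in φ..(φ + ω), ∫ s in φ..(φ + ω), (t - s) ^ 2 * deriv C t * deriv C s

/-- Integration by parts for the moments `∫ (t - a) ^ (n + 1) deriv f t dt` of the derivative. -/
lemma AbsolutelyContinuousOnInterval.integral_sub_pow_mul_deriv {f : ℝ → ℝ} {a b : ℝ}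
    (hf : AbsolutelyContinuousOnInterval f a b) (n : ℕ) :
    ∫ t in a..b, (t - a) ^ (n + 1) * deriv f t =
      (b - a) ^ (n + 1) * (f b - f a)
        - (n + 1) * ∫ t in a..b, (t - a) ^ n * (f t - f a) := by
  have hp : AbsolutelyContinuousOnInterval (fun t : ℝ => (t - a) ^ (n + 1)) a b :=
    ContDiffOn.absolutelyContinuousOnInterval (by fun_prop)
  have hc : AbsolutelyContinuousOnInterval (fun _ : ℝ => f a) a b :=
    ContDiffOn.absolutelyContinuousOnInterval (by fun_prop)
  have hd : ∀ x : ℝ, deriv (fun t : ℝ => (t - a) ^ (n + 1)) x = (n + 1) * (x - a) ^ n := by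
    intro x
    simp
  have key := hp.integral_mul_deriv_eq_deriv_mul (hf.fun_sub hc)
  simp only [deriv_sub_const_fun, hd, mul_assoc, intervalIntegral.integral_const_mul] at key
  simpa using key

open MeasureTheory in
/-- Expanding the square in `∫∫ (t - s) ^ 2 g(t) g(s) ds dt` in terms of the moments of `g`
about `c`. -/
lemma integral_integral_sq_sub_mul_mul {g : ℝ → ℝ} {a b : ℝ}
    (hg : IntervalIntegrable g volume a b) (c : ℝ) :
    ∫ t in a..b, ∫ s in a..b, (t - s) ^ 2 * g t * g s =
      2 * ((∫ t in a..b, g t) * (∫ t in a..b, (t - c) ^ 2 * g t)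
        - (∫ t in a..b, (t - c) * g t) ^ 2) := by
  have h1 : IntervalIntegrable (fun t => (t - c) * g t) volume a b :=
    hg.continuousOn_mul (by fun_prop)
  have h2 : IntervalIntegrable (fun t => (t - c) ^ 2 * g t) volume a b :=
    hg.continuousOn_mul (by fun_prop)
  have expand : ∀ p q r : ℝ, ∫ s in a..b, p * g s + q * ((s - c) * g s) + r * ((s - c) ^ 2 * g s) =
      p * (∫ s in a..b, g s) + q * (∫ s in a..b, (s - c) * g s)
        + r * ∫ s in a..b, (s - c) ^ 2 * g s := by
    intro p q r
    rw [intervalIntegral.integral_add ((hg.const_mul p).add (h1.const_mul q)) (h2.const_mul r),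
      intervalIntegral.integral_add (hg.const_mul p) (h1.const_mul q)]
    simp only [intervalIntegral.integral_const_mul]
  have inner : ∀ t, ∫ s in a..b, (t - s) ^ 2 * g t * g s =
      (∫ s in a..b, (s - c) ^ 2 * g s) * g t
        + (-2 * ∫ s in a..b, (s - c) * g s) * ((t - c) * g t)
        + (∫ s in a..b, g s) * ((t - c) ^ 2 * g t) := by
    intro t
    trans ∫ s in a..b, ((t - c) ^ 2 * g t) * g s + (-2 * ((t - c) * g t)) * ((s - c) * g s)
        + g t * ((s - c) ^ 2 * g s)
    · congr 1 with s
      ring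
    · rw [expand]
      ring
  simp only [inner]
  rw [expand]
  ring

/-- Lemma 3.6 of the paper. For a Lipschitz function `C : ℝ → ℝ`,
`P(φ, ω) = 2 Δ_ω C(φ) ∫₀^ω (ω − t) Δ_t C(φ) dt − (∫₀^ω Δ_t C(φ) dt)²`,
where `Δ_t C(φ) = C(φ + t) − C(φ)`. -/
theorem Pfun_eq_finite_difference_form (C : ℝ → ℝ) (L : NNReal) (hC : LipschitzWith L C)
    (φ ω : ℝ) :
    Pfun C φ ω =
      2 * (C (φ + ω) - C φ) * (∫ t in (0 : ℝ)..ω, (ω - t) * (C (φ + t) - C φ))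
        - (∫ t in (0 : ℝ)..ω, (C (φ + t) - C φ)) ^ 2 := by
  have hac : AbsolutelyContinuousOnInterval C φ (φ + ω) :=
    hC.lipschitzOnWith.absolutelyContinuousOnInterval
  have shift : ∀ h : ℝ → ℝ, ∫ t in φ..(φ + ω), h t = ∫ t in (0 : ℝ)..ω, h (φ + t) := by
    intro h
    simp
  have m1 := hac.integral_sub_pow_mul_deriv 0
  have m2 := hac.integral_sub_pow_mul_deriv 1
  rw [shift fun t => (t - φ) ^ 0 * (C t - C φ)] at m1
  rw [shift fun t => (t - φ) ^ 1 * (C t - C φ)] at m2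
  simp only [zero_add, pow_one, pow_zero, one_mul, add_sub_cancel_left, Nat.cast_zero,
    Nat.cast_one, Nat.reduceAdd] at m1 m2
  have hcont : Continuous C := hC.continuous
  have hJ : ∫ t in (0 : ℝ)..ω, (ω - t) * (C (φ + t) - C φ) =
      ω * (∫ t in (0 : ℝ)..ω, (C (φ + t) - C φ))
        - ∫ t in (0 : ℝ)..ω, t * (C (φ + t) - C φ) := by
    simp only [sub_mul ω]
    rw [intervalIntegral.integral_sub (Continuous.intervalIntegrable (by fun_prop) _ _)
      (Continuous.intervalIntegrable (by fun_prop) _ _), intervalIntegral.integral_const_mul]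
  rw [Pfun, integral_integral_sq_sub_mul_mul hac.intervalIntegrable_deriv φ,
    hac.integral_deriv_eq_sub, m1, m2, hJ]
  ring
end

section
/- Let C : ℝ → ℝ be nondecreasing and Lipschitz with Lipschitz constant L, let A ≥ 0 and ε > 0, and set S := {θ ∈ ℝ : C is differentiable at θ and C′(θ) ≤ A + ε}. Let φ be a Lebesgue density point of S and let ω > 0. Then there exists r₀ ∈ (0, 1) such that for every r ∈ (0, r₀) one has P(φ, rω) ≤ (1/12) (A + 2ε)² r⁴ ω⁴. -/
open MeasureTheory intervalIntegral

theorem intervalIntegral_mul_le_of_le_on {f g : ℝ → ℝ} {S : Set ℝ} {x y a L K : ℝ}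
    (hxy : x ≤ y) (hS : MeasurableSet S) (hf0 : ∀ t, 0 ≤ f t)
    (hfL : ∀ t, f t ≤ L) (ha : 0 ≤ a) (hfS : ∀ t ∈ S, f t ≤ a) (hg : Continuous g)
    (hg0 : ∀ t ∈ Set.Ioc x y, 0 ≤ g t) (hgK : ∀ t ∈ Set.Ioc x y, g t ≤ K) :
    ∫ t in x..y, g t * f t ≤
      a * (∫ t in x..y, g t) + L * K * volume.real (Set.Ioc x y \ S) := by
  have hgi : IntegrableOn g (Set.Ioc x y) :=
    (hg.integrableOn_Icc (a := x) (b := y)).mono_set Set.Ioc_subset_Icc_self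
  have hci : IntegrableOn (Sᶜ.indicator fun _ : ℝ => L * K) (Set.Ioc x y) :=
    IntegrableOn.indicator (integrableOn_const measure_Ioc_lt_top.ne) hS.compl
  have hL : 0 ≤ L := (hf0 0).trans (hfL 0)
  have hbound : ∀ t ∈ Set.Ioc x y,
      g t * f t ≤ a * g t + Sᶜ.indicator (fun _ : ℝ => L * K) t := by
    intro t ht
    by_cases hts : t ∈ S
    · have := mul_le_mul_of_nonneg_left (hfS t hts) (hg0 t ht)
      simp only [Set.mem_compl_iff, hts, not_true_eq_false, not_false_eq_true,
        Set.indicator_of_notMem]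
      linarith
    · have h₁ := mul_le_mul (hgK t ht) (hfL t) (hf0 t) ((hg0 t ht).trans (hgK t ht))
      have h₂ := mul_nonneg ha (hg0 t ht)
      rw [Set.indicator_of_mem (show t ∈ Sᶜ from hts)]
      linarith
  rw [integral_of_le hxy, integral_of_le hxy]
  calc ∫ t in Set.Ioc x y, g t * f t
      ≤ ∫ t in Set.Ioc x y, (a * g t + Sᶜ.indicator (fun _ : ℝ => L * K) t) := by
        apply integral_mono_of_nonneg
        · exact (ae_restrict_mem measurableSet_Ioc).mono fun t ht =>
            mul_nonneg (hg0 t ht) (hf0 t)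
        · exact (hgi.const_mul a).add hci
        · exact (ae_restrict_mem measurableSet_Ioc).mono hbound
    _ = _ := by
        rw [integral_add (hgi.const_mul a) hci, MeasureTheory.integral_const_mul,
          setIntegral_indicator hS.compl, setIntegral_const, ← Set.sdiff_eq, smul_eq_mul]
        ring

theorem IsDensityPoint.eventually_measureReal_diff_le {S : Set ℝ} {φ : ℝ}
    (hφ : IsDensityPoint S φ) (hS : MeasurableSet S) {δ : ℝ} (hδ : 0 < δ) :
    ∀ᶠ ρ in nhdsWithin (0 : ℝ) (Set.Ioi 0),
      volume.real (Set.Ioc φ (φ + ρ) \ S) ≤ δ * ρ := by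
  have hreal := (ENNReal.tendsto_toReal ENNReal.one_ne_top).comp hφ
  have hlt : 1 - δ / 2 < (1 : ENNReal).toReal := by simp [hδ]
  filter_upwards [hreal.eventually_const_lt hlt, self_mem_nhdsWithin] with ρ hρ hρ0
  replace hρ0 : 0 < ρ := hρ0
  simp only [Function.comp_apply, ENNReal.toReal_div,
    ENNReal.toReal_ofReal (by positivity : (0 : ℝ) ≤ 2 * ρ)] at hρ
  rw [lt_div_iff₀ (by positivity), Set.inter_comm, ← measureReal_def] at hρ
  have hsplit := measureReal_inter_add_sdiff (μ := volume) (s := Set.Icc (φ - ρ) (φ + ρ)) hS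
    measure_Icc_lt_top.ne
  have hvol : volume.real (Set.Icc (φ - ρ) (φ + ρ)) = 2 * ρ := by
    rw [Real.volume_real_Icc_of_le (by linarith)]
    ring
  have hsub : volume.real (Set.Ioc φ (φ + ρ) \ S) ≤
      volume.real (Set.Icc (φ - ρ) (φ + ρ) \ S) := by
    refine measureReal_mono (Set.sdiff_subset_sdiff_left fun t ht => ?_)
      (measure_ne_top_of_subset Set.sdiff_subset measure_Icc_lt_top.ne)
    exact ⟨by linarith [ht.1], ht.2⟩
  linarith

theorem integral_sub_sq (t x h : ℝ) :
    ∫ s in x..(x + h), (t - s) ^ 2 = ((t - x) ^ 3 + (x + h - t) ^ 3) / 3 := by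
  rw [integral_comp_sub_left (fun s => s ^ 2) t, integral_pow]
  norm_num
  ring

theorem integral_sub_cube_add_sub_cube (x h : ℝ) :
    ∫ t in x..(x + h), ((t - x) ^ 3 + (x + h - t) ^ 3) / 3 = h ^ 4 / 6 := by
  rw [intervalIntegral.integral_div, intervalIntegral.integral_add
    (Continuous.intervalIntegrable (by fun_prop) _ _)
    (Continuous.intervalIntegrable (by fun_prop) _ _),
    integral_comp_sub_right (fun s => s ^ 3) x, integral_comp_sub_left (fun s => s ^ 3) (x + h),
    integral_pow, integral_pow]
  norm_num
  ring

theorem Pfun_le_of_deriv_le_on {C : ℝ → ℝ} {S : Set ℝ} {x h a L m : ℝ} (hh : 0 ≤ h)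
    (hS : MeasurableSet S) (hf0 : ∀ t, 0 ≤ deriv C t) (hfL : ∀ t, deriv C t ≤ L)
    (ha : 0 ≤ a) (hfS : ∀ t ∈ S, deriv C t ≤ a) (hm : volume.real (Set.Ioc x (x + h) \ S) = m) :
    Pfun C x h ≤ (a ^ 2 * h ^ 4 / 6 + 4 / 3 * a * L * h ^ 3 * m + L ^ 2 * h ^ 2 * m ^ 2) / 2 := by
  have hf : Measurable (deriv C) := measurable_deriv C
  have hL : 0 ≤ L := (hf0 0).trans (hfL 0)
  have hm0 : 0 ≤ m := hm ▸ measureReal_nonneg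
  have hxh : x ≤ x + h := by linarith
  set G : ℝ → ℝ := fun t => a * (((t - x) ^ 3 + (x + h - t) ^ 3) / 3) + L * h ^ 2 * m with hG
  have hGc : Continuous G := by fun_prop
  have hG0 : ∀ t ∈ Set.Ioc x (x + h), 0 ≤ G t := fun t ht => by
    have h₁ : 0 ≤ t - x := by linarith [ht.1]
    have h₂ : 0 ≤ x + h - t := by linarith [ht.2]
    positivity
  have hGK : ∀ t ∈ Set.Ioc x (x + h), G t ≤ a * (h ^ 3 / 3) + L * h ^ 2 * m := fun t ht => by
    have h₁ : 0 ≤ t - x := by linarith [ht.1]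
    have h₂ : 0 ≤ x + h - t := by linarith [ht.2]
    have h₃ : (t - x) ^ 3 + (x + h - t) ^ 3 ≤ h ^ 3 := by
      have h₄ : 0 ≤ (t - x) * (x + h - t) * h := by positivity
      nlinarith
    simp only [hG]
    gcongr
  have hinner : ∀ t ∈ Set.Ioc x (x + h),
      ∫ s in x..(x + h), (t - s) ^ 2 * deriv C t * deriv C s ≤ G t * deriv C t := by
    intro t ht
    have key := intervalIntegral_mul_le_of_le_on (g := fun s => (t - s) ^ 2) (K := h ^ 2)
      hxh hS hf0 hfL ha hfS (by fun_prop) (fun s _ => sq_nonneg _)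
      (fun s hs => sq_le_sq' (by linarith [hs.2, ht.1]) (by linarith [hs.1, ht.2]))
    rw [integral_sub_sq, hm] at key
    have hcomm : ∀ s, (t - s) ^ 2 * deriv C t * deriv C s =
        ((t - s) ^ 2 * deriv C s) * deriv C t := fun s => by ring
    simp only [hcomm, intervalIntegral.integral_mul_const]
    exact mul_le_mul_of_nonneg_right key (hf0 t)
  have hGfi : IntegrableOn (fun t => G t * deriv C t) (Set.Ioc x (x + h)) := by
    refine Measure.integrableOn_of_bounded (M := (a * (h ^ 3 / 3) + L * h ^ 2 * m) * L)
      measure_Ioc_lt_top.ne (hGc.measurable.mul hf).aestronglyMeasurable ?_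
    refine (ae_restrict_mem measurableSet_Ioc).mono fun t ht => ?_
    rw [Real.norm_of_nonneg (mul_nonneg (hG0 t ht) (hf0 t))]
    exact mul_le_mul (hGK t ht) (hfL t) (hf0 t) (by positivity)
  have houter : ∫ t in x..(x + h), ∫ s in x..(x + h), (t - s) ^ 2 * deriv C t * deriv C s ≤
      ∫ t in x..(x + h), G t * deriv C t := by
    rw [integral_of_le hxh, integral_of_le hxh]
    apply integral_mono_of_nonneg
    · exact Filter.Eventually.of_forall fun t => integral_nonneg hxh fun s _ =>
        mul_nonneg (mul_nonneg (sq_nonneg _) (hf0 t)) (hf0 s)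
    · exact hGfi
    · exact (ae_restrict_mem measurableSet_Ioc).mono hinner
  have hGf := intervalIntegral_mul_le_of_le_on hxh hS hf0 hfL ha hfS hGc hG0 hGK
  have hGint : ∫ t in x..(x + h), G t = a * (h ^ 4 / 6) + L * h ^ 2 * m * h := by
    rw [hG, intervalIntegral.integral_add (Continuous.intervalIntegrable (by fun_prop) _ _)
      (Continuous.intervalIntegrable (by fun_prop) _ _), intervalIntegral.integral_const_mul,
      integral_sub_cube_add_sub_cube, intervalIntegral.integral_const, smul_eq_mul]
    ring
  rw [hGint, hm] at hGf
  unfold Pfun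
  linarith

/-- Step 1 of the proof of Theorem 3.7 of the paper. Let `C : ℝ → ℝ` be
nondecreasing and Lipschitz with constant `L`, `A ≥ 0`, `ε > 0`,
`S = {θ : C differentiable at θ and C′(θ) ≤ A + ε}`, `φ` a Lebesgue density point of `S`
and `ω > 0`. Then there is `r₀ ∈ (0, 1)` such that
`P(φ, rω) ≤ (1/12)(A + 2ε)² r⁴ ω⁴` for every `r ∈ (0, r₀)`. -/
theorem Pfun_upper_bound_at_density_point (C : ℝ → ℝ) (hmono : Monotone C)
    (L : NNReal) (hC : LipschitzWith L C) (A ε : ℝ) (hA : 0 ≤ A) (hε : 0 < ε)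
    (φ : ℝ)
    (hφ : IsDensityPoint {θ : ℝ | DifferentiableAt ℝ C θ ∧ deriv C θ ≤ A + ε} φ)
    (ω : ℝ) (hω : 0 < ω) :
    ∃ r₀ ∈ Set.Ioo (0 : ℝ) 1, ∀ r ∈ Set.Ioo (0 : ℝ) r₀,
      Pfun C φ (r * ω) ≤ (1 / 12) * (A + 2 * ε) ^ 2 * r ^ 4 * ω ^ 4 := by
  set S : Set ℝ := {θ : ℝ | DifferentiableAt ℝ C θ ∧ deriv C θ ≤ A + ε}
  have hS : MeasurableSet S := (measurableSet_of_differentiableAt ℝ C).inter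
    (measurableSet_le (measurable_deriv C) measurable_const)
  have hfL : ∀ t, deriv C t ≤ L := fun t =>
    (Real.le_norm_self _).trans (norm_deriv_le_of_lipschitz hC)
  have hL : (0 : ℝ) ≤ L := L.coe_nonneg
  set δ : ℝ := ε / (6 * (L + 1))
  have hδ : 0 < δ := by positivity
  have hLδ : 6 * (L * δ) ≤ ε := by
    have : δ * (6 * (L + 1)) = ε := div_mul_cancel₀ _ (by positivity)
    linarith
  obtain ⟨ρ₀, hρ₀, hsmall⟩ := mem_nhdsGT_iff_exists_Ioo_subset.1
    (hφ.eventually_measureReal_diff_le hS hδ)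
  replace hρ₀ : 0 < ρ₀ := hρ₀
  refine ⟨min (ρ₀ / ω) (1 / 2), ⟨by positivity, by norm_num⟩, fun r hr => ?_⟩
  have hr0 : 0 < r := hr.1
  have hrω : r * ω < ρ₀ := (lt_div_iff₀ hω).1 (hr.2.trans_le (min_le_left _ _))
  have hm := hsmall ⟨by positivity, hrω⟩
  simp only [Set.mem_ofPred_eq] at hm
  refine (Pfun_le_of_deriv_le_on (by positivity) hS (fun t => hmono.deriv_nonneg) hfL
    (by positivity : 0 ≤ A + ε) (fun t ht => ht.2) rfl).trans ?_
  set h : ℝ := r * ω with hh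
  have hh0 : 0 < h := by positivity
  set m := volume.real (Set.Ioc φ (φ + h) \ S)
  have hm0 : 0 ≤ m := measureReal_nonneg
  calc ((A + ε) ^ 2 * h ^ 4 / 6 + 4 / 3 * (A + ε) * L * h ^ 3 * m + L ^ 2 * h ^ 2 * m ^ 2) / 2
      ≤ ((A + ε) ^ 2 * h ^ 4 / 6 + 4 / 3 * (A + ε) * L * h ^ 3 * (δ * h)
          + L ^ 2 * h ^ 2 * (δ * h) ^ 2) / 2 := by gcongr
    _ = ((A + ε) ^ 2 / 6 + 4 / 3 * (A + ε) * (L * δ) + (L * δ) ^ 2) / 2 * h ^ 4 := by ring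
    _ ≤ ((A + 2 * ε) ^ 2 / 12) * h ^ 4 := by
        have h₀ : 0 ≤ L * δ := by positivity
        refine mul_le_mul_of_nonneg_right ?_ (by positivity)
        nlinarith [mul_le_mul_of_nonneg_left hLδ (by positivity : 0 ≤ A + ε),
          mul_self_le_mul_self (by positivity) hLδ]
    _ = (1 / 12) * (A + 2 * ε) ^ 2 * r ^ 4 * ω ^ 4 := by rw [hh]; ring
end

section
/- Let A ≥ 0, B ≥ 0, ω > 0, and let g : [0, ω] → ℝ be continuous with A·t ≤ g(t) ≤ (A + B)·t for all t ∈ [0, ω] and g(ω) = (A + B)·ω. Then 2 (A + B) ω ∫₀^ω (ω − t) g(t) dt − ( ∫₀^ω g(t) dt )² ≥ (1/12) A² ω⁴ + (1/8) A B ω⁴. -/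
open intervalIntegral

theorem integral_sub_mul_mul_self (a b k c : ℝ) :
    ∫ t in a..b, (c - t) * (k * t) = k * (c * (b ^ 2 - a ^ 2) / 2 - (b ^ 3 - a ^ 3) / 3) := by
  have h (t : ℝ) : HasDerivAt (fun t : ℝ => k * (c * t ^ 2 / 2 - t ^ 3 / 3))
      ((c - t) * (k * t)) t := by
    have h2 := ((hasDerivAt_pow 2 t).const_mul c).div_const 2
    have h3 := (hasDerivAt_pow 3 t).div_const 3
    refine ((h2.sub h3).const_mul k).congr_deriv ?_
    norm_num
    ring
  rw [integral_eq_sub_of_hasDerivAt (fun t _ => h t)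
    (Continuous.intervalIntegrable (by fun_prop) _ _)]
  ring

/-- The bathtub inequality: tested against the weight `c - t`, a function between `A t` and
`M t` is minimized by the one that jumps from the lower to the upper bound at `c`. -/
theorem le_integral_sub_mul_of_linear_bounds {A M w c : ℝ} {g : ℝ → ℝ} (hc : c ∈ Set.Icc 0 w)
    (hg : ContinuousOn g (Set.Icc 0 w))
    (hlow : ∀ t ∈ Set.Icc (0 : ℝ) w, A * t ≤ g t)
    (hupp : ∀ t ∈ Set.Icc (0 : ℝ) w, g t ≤ M * t) :
    A * (c ^ 3 / 6) + M * (c * (w ^ 2 - c ^ 2) / 2 - (w ^ 3 - c ^ 3) / 3)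
      ≤ ∫ t in (0 : ℝ)..w, (c - t) * g t := by
  obtain ⟨hc0, hcw⟩ := hc
  have hcont : ContinuousOn (fun t => (c - t) * g t) (Set.Icc 0 w) :=
    ContinuousOn.mul (by fun_prop) hg
  have hint1 : IntervalIntegrable (fun t => (c - t) * g t) MeasureTheory.volume 0 c :=
    (hcont.mono (Set.Icc_subset_Icc_right hcw)).intervalIntegrable_of_Icc hc0
  have hint2 : IntervalIntegrable (fun t => (c - t) * g t) MeasureTheory.volume c w :=
    (hcont.mono (Set.Icc_subset_Icc_left hc0)).intervalIntegrable_of_Icc hcw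
  have h1 : ∫ t in (0 : ℝ)..c, (c - t) * (A * t) ≤ ∫ t in (0 : ℝ)..c, (c - t) * g t :=
    integral_mono_on hc0 (Continuous.intervalIntegrable (by fun_prop) _ _) hint1
      fun t ht => mul_le_mul_of_nonneg_left (hlow t ⟨ht.1, ht.2.trans hcw⟩)
        (sub_nonneg.2 ht.2)
  have h2 : ∫ t in c..w, (c - t) * (M * t) ≤ ∫ t in c..w, (c - t) * g t :=
    integral_mono_on hcw (Continuous.intervalIntegrable (by fun_prop) _ _) hint2
      fun t ht => mul_le_mul_of_nonpos_left (hupp t ⟨hc0.trans ht.1, ht.2⟩)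
        (sub_nonpos.2 ht.1)
  rw [integral_sub_mul_mul_self] at h1 h2
  rw [← integral_add_adjacent_intervals hint1 hint2]
  linarith

/-- Step 2 of the proof of Theorem 3.7 of the paper. Let `A ≥ 0`, `B ≥ 0`,
`ω > 0`, and let `g : [0, ω] → ℝ` be continuous with `A t ≤ g t ≤ (A + B) t` on `[0, ω]`
and `g ω = (A + B) ω`. Then
`2 (A + B) ω ∫₀^ω (ω − t) g(t) dt − (∫₀^ω g(t) dt)² ≥ (1/12) A² ω⁴ + (1/8) A B ω⁴`. -/
theorem step2_lower_bound (A B ω : ℝ) (hA : 0 ≤ A) (hB : 0 ≤ B) (hω : 0 < ω)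
    (g : ℝ → ℝ) (hg : ContinuousOn g (Set.Icc 0 ω))
    (hlow : ∀ t ∈ Set.Icc (0 : ℝ) ω, A * t ≤ g t)
    (hupp : ∀ t ∈ Set.Icc (0 : ℝ) ω, g t ≤ (A + B) * t)
    (hend : g ω = (A + B) * ω) :
    2 * (A + B) * ω * (∫ t in (0 : ℝ)..ω, (ω - t) * g t)
        - (∫ t in (0 : ℝ)..ω, g t) ^ 2
      ≥ (1 / 12) * A ^ 2 * ω ^ 4 + (1 / 8) * A * B * ω ^ 4 := by
  have hgi : IntervalIntegrable g MeasureTheory.volume 0 ω :=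
    hg.intervalIntegrable_of_Icc hω.le
  have hI1 : A * ω ^ 2 / 2 ≤ ∫ t in (0 : ℝ)..ω, g t := by
    have h := integral_mono_on hω.le (Continuous.intervalIntegrable (by fun_prop) _ _) hgi hlow
    rw [integral_const_mul, integral_id] at h
    linarith
  have hI2 : ∫ t in (0 : ℝ)..ω, g t ≤ (A + B) * ω ^ 2 / 2 := by
    have h := integral_mono_on hω.le hgi (Continuous.intervalIntegrable (by fun_prop) _ _) hupp
    rw [integral_const_mul, integral_id] at h
    linarith
  have hsplit (c : ℝ) : ∫ t in (0 : ℝ)..ω, (ω - t) * g t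
      = (∫ t in (0 : ℝ)..ω, (c - t) * g t) + (ω - c) * ∫ t in (0 : ℝ)..ω, g t := by
    have hci : IntervalIntegrable (fun t => (c - t) * g t) MeasureTheory.volume 0 ω :=
      (ContinuousOn.mul (by fun_prop) hg).intervalIntegrable_of_Icc hω.le
    rw [← integral_const_mul, ← integral_add hci (hgi.const_mul _)]
    congr 1
    ext t
    ring
  set I := ∫ t in (0 : ℝ)..ω, g t
  obtain ⟨c, hc, hcI⟩ : ∃ c ∈ Set.Icc 0 ω, A * ω ^ 2 + B * (ω ^ 2 - c ^ 2) = 2 * I := by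
    have hcont : ContinuousOn (fun c : ℝ => A * ω ^ 2 + B * (ω ^ 2 - c ^ 2)) (Set.Icc 0 ω) := by
      fun_prop
    exact intermediate_value_Icc' hω.le hcont ⟨by linarith, by linarith⟩
  have hJ : A * ω ^ 3 / 6 + B * (ω ^ 3 / 6 - ω * c ^ 2 / 2 + c ^ 3 / 3)
      ≤ ∫ t in (0 : ℝ)..ω, (ω - t) * g t := by
    have h := le_integral_sub_mul_of_linear_bounds hc hg hlow hupp
    rw [hsplit c, show I = (A * ω ^ 2 + B * (ω ^ 2 - c ^ 2)) / 2 by linarith]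
    linarith
  obtain ⟨hc0, hcω⟩ := hc
  have hmain := mul_le_mul_of_nonneg_left hJ (by positivity : 0 ≤ 2 * (A + B) * ω)
  have hAB : 0 ≤ A * B * (ω * ((ω - 2 * c) ^ 2 * (ω + 4 * c))) := by positivity
  have hBB : 0 ≤ B ^ 2 * ((ω - c) ^ 3 * (ω + 3 * c)) := by
    have := sub_nonneg.2 hcω
    positivity
  rw [show I = (A * ω ^ 2 + B * (ω ^ 2 - c ^ 2)) / 2 by linarith]
  linarith
end

section
/- Let B ≥ 0, ω > 0, and let f : [0, ω] → ℝ be integrable with 0 ≤ f(t) ≤ B·t for all t ∈ [0, ω]. Then 2 B ω ∫₀^ω (ω − t) f(t) dt − ( ∫₀^ω f(t) dt )² ≥ 0. -/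
open MeasureTheory intervalIntegral

/-- The tangent-line lower bound for the first moment `∫₀^ω (ω - t) f(t) dt`, obtained by comparing
`f` with `t ↦ B * t` on `[s, ω]`. -/
lemma integral_sub_mul_ge {B ω s : ℝ} (hs0 : 0 ≤ s) (hsω : s ≤ ω) {f : ℝ → ℝ}
    (hf : IntervalIntegrable f volume 0 ω)
    (hlow : ∀ t ∈ Set.Icc (0 : ℝ) ω, 0 ≤ f t)
    (hupp : ∀ t ∈ Set.Icc (0 : ℝ) ω, f t ≤ B * t) :
    (ω - s) * (∫ t in (0 : ℝ)..ω, f t) - B * (ω ^ 3 / 3 - s * ω ^ 2 / 2 + s ^ 3 / 6)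
      ≤ ∫ t in (0 : ℝ)..ω, (ω - t) * f t := by
  have hω : 0 ≤ ω := hs0.trans hsω
  have hg : IntervalIntegrable (fun t => (s - t) * f t) volume 0 ω :=
    hf.continuousOn_mul (by fun_prop)
  have hg₁ : IntervalIntegrable (fun t => (s - t) * f t) volume 0 s :=
    hg.mono_set (by
      rw [Set.uIcc_of_le hs0, Set.uIcc_of_le hω]
      exact Set.Icc_subset_Icc_right hsω)
  have hg₂ : IntervalIntegrable (fun t => (s - t) * f t) volume s ω :=
    hg.mono_set (by
      rw [Set.uIcc_of_le hsω, Set.uIcc_of_le hω]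
      exact Set.Icc_subset_Icc_left hs0)
  have hsplit : (∫ t in (0 : ℝ)..ω, (ω - t) * f t)
      = (ω - s) * (∫ t in (0 : ℝ)..ω, f t) + ∫ t in (0 : ℝ)..ω, (s - t) * f t := by
    rw [← intervalIntegral.integral_const_mul, ← integral_add (hf.const_mul _) hg]
    congr 1
    ext t
    ring
  have hleft : 0 ≤ ∫ t in (0 : ℝ)..s, (s - t) * f t :=
    integral_nonneg hs0 fun t ht =>
      mul_nonneg (sub_nonneg.2 ht.2) (hlow t ⟨ht.1, ht.2.trans hsω⟩)
  have hright : (∫ t in s..ω, (s - t) * (B * t)) ≤ ∫ t in s..ω, (s - t) * f t :=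
    integral_mono_on hsω (Continuous.intervalIntegrable (by fun_prop) _ _) hg₂ fun t ht =>
      mul_le_mul_of_nonpos_left (hupp t ⟨hs0.trans ht.1, ht.2⟩) (sub_nonpos.2 ht.1)
  have hcalc : (∫ t in s..ω, (s - t) * (B * t))
      = -(B * (ω ^ 3 / 3 - s * ω ^ 2 / 2 + s ^ 3 / 6)) := by
    have hexpand : (fun t : ℝ => (s - t) * (B * t)) = fun t => s * B * t - B * t ^ 2 := by
      ext t
      ring
    rw [hexpand, integral_sub (Continuous.intervalIntegrable (by fun_prop) _ _)
      (Continuous.intervalIntegrable (by fun_prop) _ _), intervalIntegral.integral_const_mul,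
      intervalIntegral.integral_const_mul, integral_id, integral_pow]
    push_cast
    ring
  rw [hsplit, ← integral_add_adjacent_intervals hg₁ hg₂]
  linarith

/-- nonnegativity claim in Step 2 of the proof of Theorem 3.7 of the
paper. Let `B ≥ 0`, `ω > 0` and `f : [0, ω] → ℝ` be integrable with `0 ≤ f t ≤ B t` on
`[0, ω]`. Then `2 B ω ∫₀^ω (ω − t) f(t) dt − (∫₀^ω f(t) dt)² ≥ 0`. -/
theorem step2_nonnegativity (B ω : ℝ) (hB : 0 ≤ B) (hω : 0 < ω) (f : ℝ → ℝ)
    (hf : IntegrableOn f (Set.Icc 0 ω))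
    (hlow : ∀ t ∈ Set.Icc (0 : ℝ) ω, 0 ≤ f t)
    (hupp : ∀ t ∈ Set.Icc (0 : ℝ) ω, f t ≤ B * t) :
    2 * B * ω * (∫ t in (0 : ℝ)..ω, (ω - t) * f t)
        - (∫ t in (0 : ℝ)..ω, f t) ^ 2 ≥ 0 := by
  have hint : IntervalIntegrable f volume 0 ω :=
    (intervalIntegrable_iff_integrableOn_Icc_of_le hω.le).2 hf
  have hI0 : 0 ≤ ∫ t in (0 : ℝ)..ω, f t := integral_nonneg hω.le hlow
  have hI1 : (∫ t in (0 : ℝ)..ω, f t) ≤ B * (ω ^ 2 / 2) := by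
    have hle : (∫ t in (0 : ℝ)..ω, f t) ≤ ∫ t in (0 : ℝ)..ω, B * t :=
      integral_mono_on hω.le hint (Continuous.intervalIntegrable (by fun_prop) _ _) hupp
    rw [intervalIntegral.integral_const_mul, integral_id] at hle
    linarith
  obtain ⟨s, hs0, hsω, hs⟩ : ∃ s : ℝ, 0 ≤ s ∧ s ≤ ω ∧
      (∫ t in (0 : ℝ)..ω, f t) = B * ((ω ^ 2 - s ^ 2) / 2) := by
    have hcont : ContinuousOn (fun s : ℝ => B * ((ω ^ 2 - s ^ 2) / 2)) (Set.Icc 0 ω) := by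
      fun_prop
    obtain ⟨s, hs, hsI⟩ := intermediate_value_Icc' hω.le hcont
      (show (∫ t in (0 : ℝ)..ω, f t) ∈ _ from ⟨by simpa using hI0, by simpa using hI1⟩)
    exact ⟨s, hs.1, hs.2, hsI.symm⟩
  have hJ := integral_sub_mul_ge hs0 hsω hint hlow hupp
  rw [hs] at hJ ⊢
  have hmul := mul_le_mul_of_nonneg_left hJ (by positivity : 0 ≤ 2 * B * ω)
  have hrem : 0 ≤ B ^ 2 * (ω - s) ^ 3 * (3 * s + ω) / 12 := by
    have := sub_nonneg.2 hsω
    positivity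
  linear_combination hmul + hrem
end

section
/- Let B ≥ 0, ω > 0, and let f : [0, ω] → ℝ be integrable with 0 ≤ f(t) ≤ B·t for all t ∈ [0, ω]. Suppose s ∈ [0, ω] satisfies ∫_s^ω B·t dt = ∫₀^ω f(t) dt. Then ∫₀^ω (ω − t) f(t) dt ≥ ∫_s^ω (ω − t) B·t dt. -/
open MeasureTheory intervalIntegral

/-- bathtub-type rearrangement inequality from Step 2 of the proof of
Theorem 3.7 of the paper. Let `B ≥ 0`, `ω > 0` and `f : [0, ω] → ℝ` be integrable with
`0 ≤ f t ≤ B t` on `[0, ω]`. If `s ∈ [0, ω]` satisfies `∫_s^ω B t dt = ∫₀^ω f(t) dt`,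
then `∫₀^ω (ω − t) f(t) dt ≥ ∫_s^ω (ω − t) B t dt`. -/
theorem bathtub_rearrangement (B ω : ℝ) (hB : 0 ≤ B) (hω : 0 < ω) (f : ℝ → ℝ)
    (hf : IntegrableOn f (Set.Icc 0 ω))
    (hlow : ∀ t ∈ Set.Icc (0 : ℝ) ω, 0 ≤ f t)
    (hupp : ∀ t ∈ Set.Icc (0 : ℝ) ω, f t ≤ B * t)
    (s : ℝ) (hs : s ∈ Set.Icc (0 : ℝ) ω)
    (hint : (∫ t in s..ω, B * t) = ∫ t in (0 : ℝ)..ω, f t) :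
    (∫ t in (0 : ℝ)..ω, (ω - t) * f t) ≥ ∫ t in s..ω, (ω - t) * (B * t) := by
  obtain ⟨hs0, hsω⟩ := hs
  have hf₀ : IntervalIntegrable f volume 0 s :=
    (intervalIntegrable_iff_integrableOn_Icc_of_le hs0).2
      (hf.mono_set (Set.Icc_subset_Icc le_rfl hsω))
  have hf₁ : IntervalIntegrable f volume s ω :=
    (intervalIntegrable_iff_integrableOn_Icc_of_le hsω).2
      (hf.mono_set (Set.Icc_subset_Icc hs0 le_rfl))
  have hg : IntervalIntegrable (fun t => B * t) volume s ω :=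
    Continuous.intervalIntegrable (by fun_prop) _ _
  have hwf₀ : IntervalIntegrable (fun t => (ω - t) * f t) volume 0 s :=
    hf₀.continuousOn_mul (by fun_prop)
  have hwf₁ : IntervalIntegrable (fun t => (ω - t) * f t) volume s ω :=
    hf₁.continuousOn_mul (by fun_prop)
  have hwg : IntervalIntegrable (fun t => (ω - t) * (B * t)) volume s ω :=
    Continuous.intervalIntegrable (by fun_prop) _ _
  have left_bound : (ω - s) * ∫ t in (0 : ℝ)..s, f t ≤ ∫ t in (0 : ℝ)..s, (ω - t) * f t := by
    rw [← intervalIntegral.integral_const_mul]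
    refine integral_mono_on hs0 (hf₀.const_mul _) hwf₀ fun t ht => ?_
    exact mul_le_mul_of_nonneg_right (by linarith [ht.2]) (hlow t ⟨ht.1, ht.2.trans hsω⟩)
  have right_bound : (∫ t in s..ω, ((ω - t) * (B * t) - (ω - t) * f t)) ≤
      ∫ t in s..ω, (ω - s) * (B * t - f t) := by
    refine integral_mono_on hsω (hwg.sub hwf₁) ((hg.sub hf₁).const_mul _) fun t ht => ?_
    nlinarith [ht.1, hupp t ⟨hs0.trans ht.1, ht.2⟩]
  rw [intervalIntegral.integral_const_mul, integral_sub hwg hwf₁, integral_sub hg hf₁, hint,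
    ← integral_add_adjacent_intervals hf₀ hf₁, add_sub_cancel_right] at right_bound
  rw [← integral_add_adjacent_intervals hwf₀ hwf₁]
  linarith
end

section
/- Let k ≥ 1 be an integer. Let fₙ (n ∈ ℕ) and f be proper C^k functions ℝ² → ℝ such that fₙ → f in C^k_loc(ℝ²). Assume 1 is a regular value of f and of each fₙ, and that the level sets {f = 1} and {fₙ = 1} are connected (hence, being compact 1-dimensional submanifolds, simple closed curves). Let γₙ, γ : [0,1] → ℝ² be C^k closed curves of constant Euclidean speed, injective on [0,1), positively oriented (i.e. ∫₀¹ (γ₁ γ₂′ − γ₂ γ₁′) dt > 0), with image equal to {fₙ = 1} and {f = 1} respectively, and such that γₙ(0) → γ(0) and γₙ(1) → γ(1). Then γₙ → γ in C^k([0,1]), i.e. the derivatives of γₙ up to order k converge uniformly on [0,1] to those of γ. -/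
open Set Filter intervalIntegral
open scoped Topology ContDiff

/-! ### Locally uniform convergence of derivatives -/

section ContDiffConvergence

lemma tendstoLocallyUniformlyOn_iff_tendsto_prod {ι X Y : Type*} [TopologicalSpace X]
    [UniformSpace Y] {F : ι → X → Y} {f : X → Y} {l : Filter ι} {s : Set X}
    (hf : ContinuousOn f s) :
    TendstoLocallyUniformlyOn F f l s ↔
      ∀ x ∈ s, Tendsto (fun q : ι × X => F q.1 q.2) (l ×ˢ 𝓝[s] x) (𝓝 (f x)) := by
  rw [tendstoLocallyUniformlyOn_iff_forall_tendsto]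
  refine forall₂_congr fun x hx => ?_
  have h : Tendsto (fun q : ι × X => (f x, f q.2)) (l ×ˢ 𝓝[s] x) (uniformity Y) :=
    Uniform.tendsto_nhds_right.1 ((hf x hx).tendsto.comp tendsto_snd)
  rw [Uniform.tendsto_nhds_right]
  exact ⟨fun h' => h.uniformity_trans h', fun h' => h.uniformity_symm.uniformity_trans h'⟩

lemma eventually_snd_mem_prod_nhdsWithin {ι X : Type*} [TopologicalSpace X] {l : Filter ι}
    {s : Set X} (x : X) : ∀ᶠ q in l ×ˢ 𝓝[s] x, q.2 ∈ s :=
  tendsto_snd.eventually self_mem_nhdsWithin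

variable {ι E F G : Type} [NormedAddCommGroup E] [NormedSpace ℝ E]
  [NormedAddCommGroup F] [NormedSpace ℝ F] [NormedAddCommGroup G] [NormedSpace ℝ G]

/-- The functions `φ n` converge to `φ₀` along `l`, locally uniformly on `s` together with their
derivatives of order at most `j`. -/
def TendstoContDiffOn (j : ℕ) (φ : ι → E → F) (φ₀ : E → F) (l : Filter ι) (s : Set E) : Prop :=
  (∀ n, ContDiffOn ℝ j (φ n) s) ∧ ContDiffOn ℝ j φ₀ s ∧
    ∀ i ≤ j, ∀ x ∈ s, Tendsto (fun q : ι × E => iteratedFDerivWithin ℝ i (φ q.1) s q.2)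
      (l ×ˢ 𝓝[s] x) (𝓝 (iteratedFDerivWithin ℝ i φ₀ s x))

variable {j : ℕ} {φ ψ : ι → E → F} {φ₀ ψ₀ : E → F} {l : Filter ι} {s : Set E} {t : Set F}

lemma tendsto_iteratedFDerivWithin_zero_iff {x : E} :
    Tendsto (fun q : ι × E => iteratedFDerivWithin ℝ 0 (φ q.1) s q.2)
      (l ×ˢ 𝓝[s] x) (𝓝 (iteratedFDerivWithin ℝ 0 φ₀ s x)) ↔
    Tendsto (fun q : ι × E => φ q.1 q.2) (l ×ˢ 𝓝[s] x) (𝓝 (φ₀ x)) := by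
  simp only [iteratedFDerivWithin_zero_eq_comp, Function.comp_apply]
  exact ((continuousMultilinearCurryFin0 ℝ E F).symm.toHomeomorph.isInducing.tendsto_nhds_iff
    (f := fun q : ι × E => φ q.1 q.2)).symm

lemma tendsto_iteratedFDerivWithin_succ_iff {i : ℕ} (hs : UniqueDiffOn ℝ s) {x : E}
    (hx : x ∈ s) :
    Tendsto (fun q : ι × E => iteratedFDerivWithin ℝ (i + 1) (φ q.1) s q.2)
      (l ×ˢ 𝓝[s] x) (𝓝 (iteratedFDerivWithin ℝ (i + 1) φ₀ s x)) ↔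
    Tendsto (fun q : ι × E => iteratedFDerivWithin ℝ i (fderivWithin ℝ (φ q.1) s) s q.2)
      (l ×ˢ 𝓝[s] x) (𝓝 (iteratedFDerivWithin ℝ i (fderivWithin ℝ φ₀ s) s x)) := by
  rw [iteratedFDerivWithin_succ_eq_comp_right hs hx]
  have h : (fun q : ι × E => iteratedFDerivWithin ℝ (i + 1) (φ q.1) s q.2)
      =ᶠ[l ×ˢ 𝓝[s] x] fun q => (continuousMultilinearCurryRightEquiv' ℝ i E F).symm
        (iteratedFDerivWithin ℝ i (fderivWithin ℝ (φ q.1) s) s q.2) := by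
    filter_upwards [eventually_snd_mem_prod_nhdsWithin x] with q hq
    exact iteratedFDerivWithin_succ_eq_comp_right hs hq
  rw [tendsto_congr' h]
  exact (continuousMultilinearCurryRightEquiv' ℝ i E
    F).symm.toHomeomorph.isInducing.tendsto_nhds_iff
    (f := fun q : ι × E => iteratedFDerivWithin ℝ i (fderivWithin ℝ (φ q.1) s) s q.2) |>.symm

lemma tendstoContDiffOn_zero_iff :
    TendstoContDiffOn 0 φ φ₀ l s ↔ (∀ n, ContinuousOn (φ n) s) ∧ ContinuousOn φ₀ s ∧
      ∀ x ∈ s, Tendsto (fun q : ι × E => φ q.1 q.2) (l ×ˢ 𝓝[s] x) (𝓝 (φ₀ x)) := by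
  simp only [TendstoContDiffOn, Nat.cast_zero, contDiffOn_zero, Nat.le_zero, forall_eq,
    tendsto_iteratedFDerivWithin_zero_iff]

lemma tendstoContDiffOn_succ_iff (hs : UniqueDiffOn ℝ s) :
    TendstoContDiffOn (j + 1) φ φ₀ l s ↔
      (∀ n, DifferentiableOn ℝ (φ n) s) ∧ DifferentiableOn ℝ φ₀ s ∧
      (∀ x ∈ s, Tendsto (fun q : ι × E => φ q.1 q.2) (l ×ˢ 𝓝[s] x) (𝓝 (φ₀ x))) ∧
      TendstoContDiffOn j (fun n => fderivWithin ℝ (φ n) s) (fderivWithin ℝ φ₀ s) l s := by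
  have key : ∀ g : E → F, ContDiffOn ℝ ((j + 1 : ℕ) : ℕ∞ω) g s ↔
      DifferentiableOn ℝ g s ∧ ContDiffOn ℝ j (fderivWithin ℝ g s) s := fun g => by
    rw [Nat.cast_add, Nat.cast_one, contDiffOn_succ_iff_fderivWithin hs]
    simp
  simp only [TendstoContDiffOn, key, forall_and]
  have : (∀ i ≤ j + 1, ∀ x ∈ s, Tendsto (fun q : ι × E => iteratedFDerivWithin ℝ i (φ q.1) s q.2)
      (l ×ˢ 𝓝[s] x) (𝓝 (iteratedFDerivWithin ℝ i φ₀ s x))) ↔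
      (∀ x ∈ s, Tendsto (fun q : ι × E => φ q.1 q.2) (l ×ˢ 𝓝[s] x) (𝓝 (φ₀ x))) ∧
      ∀ i ≤ j, ∀ x ∈ s,
        Tendsto (fun q : ι × E => iteratedFDerivWithin ℝ i (fderivWithin ℝ (φ q.1) s) s q.2)
        (l ×ˢ 𝓝[s] x) (𝓝 (iteratedFDerivWithin ℝ i (fderivWithin ℝ φ₀ s) s x)) := by
    constructor
    · intro h
      exact ⟨fun x hx => tendsto_iteratedFDerivWithin_zero_iff.1 (h 0 (Nat.zero_le _) x hx),
        fun i hi x hx => (tendsto_iteratedFDerivWithin_succ_iff hs hx).1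
          (h (i + 1) (Nat.succ_le_succ hi) x hx)⟩
    · rintro ⟨h0, h1⟩ (_ | i) hi x hx
      · exact tendsto_iteratedFDerivWithin_zero_iff.2 (h0 x hx)
      · exact (tendsto_iteratedFDerivWithin_succ_iff hs hx).2
          (h1 i (Nat.le_of_succ_le_succ hi) x hx)
  rw [this]
  tauto

lemma TendstoContDiffOn.mono (h : TendstoContDiffOn j φ φ₀ l s) {i : ℕ} (hij : i ≤ j) :
    TendstoContDiffOn i φ φ₀ l s :=
  ⟨fun n => (h.1 n).of_le (mod_cast hij), h.2.1.of_le (mod_cast hij),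
    fun m hm => h.2.2 m (hm.trans hij)⟩

lemma TendstoContDiffOn.mono_filter (h : TendstoContDiffOn j φ φ₀ l s) {l' : Filter ι}
    (hl : l' ≤ l) : TendstoContDiffOn j φ φ₀ l' s :=
  ⟨h.1, h.2.1, fun m hm x hx => (h.2.2 m hm x hx).mono_left (prod_mono_left _ hl)⟩

lemma TendstoContDiffOn.tendsto (h : TendstoContDiffOn j φ φ₀ l s) {x : E} (hx : x ∈ s) :
    Tendsto (fun q : ι × E => φ q.1 q.2) (l ×ˢ 𝓝[s] x) (𝓝 (φ₀ x)) :=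
  (tendstoContDiffOn_zero_iff.1 (h.mono (Nat.zero_le _))).2.2 x hx

lemma TendstoContDiffOn.congr (h : TendstoContDiffOn j φ φ₀ l s)
    (hφ : ∀ n, EqOn (ψ n) (φ n) s) (hφ₀ : EqOn ψ₀ φ₀ s) : TendstoContDiffOn j ψ ψ₀ l s := by
  refine ⟨fun n => (h.1 n).congr (hφ n), h.2.1.congr hφ₀, fun i hi x hx => ?_⟩
  rw [iteratedFDerivWithin_congr hφ₀ hx]
  refine (h.2.2 i hi x hx).congr' ?_
  filter_upwards [eventually_snd_mem_prod_nhdsWithin x] with q hq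
  rw [iteratedFDerivWithin_congr (hφ q.1) hq]

lemma tendstoContDiffOn_const (h : ContDiffOn ℝ j φ₀ s) (hs : UniqueDiffOn ℝ s) :
    TendstoContDiffOn j (fun _ : ι => φ₀) φ₀ l s :=
  ⟨fun _ => h, h, fun _ hi x hx =>
    ((h.continuousOn_iteratedFDerivWithin (mod_cast hi) hs) x hx).tendsto.comp tendsto_snd⟩

lemma tendstoContDiffOn_of_tendsto {a : ι → F} {a₀ : F} (h : Tendsto a l (𝓝 a₀))
    (hs : UniqueDiffOn ℝ s) : TendstoContDiffOn j (fun n _ => a n) (fun _ => a₀) l s := by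
  cases j with
  | zero =>
    exact tendstoContDiffOn_zero_iff.2 ⟨fun _ => continuousOn_const, continuousOn_const,
      fun x _ => h.comp tendsto_fst⟩
  | succ j =>
    refine (tendstoContDiffOn_succ_iff hs).2 ⟨fun _ => differentiableOn_const _,
      differentiableOn_const _, fun x _ => h.comp tendsto_fst, ?_⟩
    simp only [fderivWithin_fun_const]
    exact tendstoContDiffOn_const contDiffOn_const hs

lemma TendstoContDiffOn.prodMk {χ : ι → E → G} {χ₀ : E → G} (hs : UniqueDiffOn ℝ s)
    (h : TendstoContDiffOn j φ φ₀ l s) (h' : TendstoContDiffOn j χ χ₀ l s) :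
    TendstoContDiffOn j (fun n x => (φ n x, χ n x)) (fun x => (φ₀ x, χ₀ x)) l s := by
  refine ⟨fun n => (h.1 n).prodMk (h'.1 n), h.2.1.prodMk h'.2.1, fun i hi x hx => ?_⟩
  rw [iteratedFDerivWithin_prodMk (h.2.1 x hx) (h'.2.1 x hx) hs hx (mod_cast hi)]
  have hc := (ContinuousMultilinearMap.prodL ℝ (fun _ : Fin i => E) F G).continuous.tendsto
    (iteratedFDerivWithin ℝ i φ₀ s x, iteratedFDerivWithin ℝ i χ₀ s x)
  refine (hc.comp ((h.2.2 i hi x hx).prodMk_nhds (h'.2.2 i hi x hx))).congr' ?_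
  filter_upwards [eventually_snd_mem_prod_nhdsWithin x] with q hq
  rw [iteratedFDerivWithin_prodMk (h.1 _ _ hq) (h'.1 _ _ hq) hs hq (mod_cast hi)]
  rfl

lemma TendstoContDiffOn.comp {E F G : Type} [NormedAddCommGroup E] [NormedSpace ℝ E]
    [NormedAddCommGroup F] [NormedSpace ℝ F] [NormedAddCommGroup G] [NormedSpace ℝ G]
    {φ : ι → E → F} {φ₀ : E → F} {s : Set E} {t : Set F}
    {χ : ι → F → G} {χ₀ : F → G} (hs : UniqueDiffOn ℝ s)
    (ht : UniqueDiffOn ℝ t) (h' : TendstoContDiffOn j χ χ₀ l t)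
    (h : TendstoContDiffOn j φ φ₀ l s)
    (hst : ∀ n, MapsTo (φ n) s t) (hst₀ : MapsTo φ₀ s t) :
    TendstoContDiffOn j (fun n x => χ n (φ n x)) (fun x => χ₀ (φ₀ x)) l s := by
  have tends : ∀ x ∈ s, Tendsto (fun q : ι × E => χ q.1 (φ q.1 q.2)) (l ×ˢ 𝓝[s] x)
      (𝓝 (χ₀ (φ₀ x))) := fun x hx => by
    have h1 : Tendsto (fun q : ι × E => φ q.1 q.2) (l ×ˢ 𝓝[s] x) (𝓝[t] (φ₀ x)) :=
      tendsto_nhdsWithin_iff.2 ⟨h.tendsto hx, (eventually_snd_mem_prod_nhdsWithin x).mono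
        fun q hq => hst q.1 hq⟩
    exact (h'.tendsto (hst₀ hx)).comp (tendsto_fst.prodMk h1)
  induction j generalizing E F G with
  | zero =>
    exact tendstoContDiffOn_zero_iff.2 ⟨fun n => (h'.1 n).continuousOn.comp (h.1 n).continuousOn
      (hst n), h'.2.1.continuousOn.comp h.2.1.continuousOn hst₀, tends⟩
  | succ j ih =>
    obtain ⟨hd, hd₀, -, hD⟩ := (tendstoContDiffOn_succ_iff hs).1 h
    obtain ⟨hd', hd₀', -, hD'⟩ := (tendstoContDiffOn_succ_iff ht).1 h'
    refine (tendstoContDiffOn_succ_iff hs).2 ⟨fun n => (hd' n).comp (hd n) (hst n),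
      hd₀'.comp hd₀ hst₀, tends, ?_⟩
    have hmono := h.mono (Nat.le_succ j)
    have hcomp := ih hs ht hD' hmono hst hst₀ fun x hx => by
      have h1 : Tendsto (fun q : ι × E => φ q.1 q.2) (l ×ˢ 𝓝[s] x) (𝓝[t] (φ₀ x)) :=
        tendsto_nhdsWithin_iff.2 ⟨h.tendsto hx, (eventually_snd_mem_prod_nhdsWithin x).mono
          fun q hq => hst q.1 hq⟩
      exact (hD'.tendsto (hst₀ hx)).comp (tendsto_fst.prodMk h1)
    have hpair := hcomp.prodMk hs hD
    have hbil : TendstoContDiffOn j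
        (fun (_ : ι) (p : (F →L[ℝ] G) × (E →L[ℝ] F)) => p.1.comp p.2)
        (fun p => p.1.comp p.2) l univ :=
      tendstoContDiffOn_const isBoundedBilinearMap_comp.contDiff.contDiffOn uniqueDiffOn_univ
    refine (ih hs uniqueDiffOn_univ hbil hpair (fun _ _ _ => mem_univ _) (fun _ _ => mem_univ _)
      fun x hx => ?_).congr (fun n x hx => ?_) (fun x hx => ?_)
    · exact (hbil.tendsto (mem_univ _)).comp
        (tendsto_fst.prodMk (tendsto_nhdsWithin_iff.2 ⟨hpair.tendsto hx, by simp⟩))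
    · exact fderivWithin_comp x (hd' n _ (hst n hx)) (hd n x hx) (hst n) (hs x hx)
    · exact fderivWithin_comp x (hd₀' _ (hst₀ hx)) (hd₀ x hx) hst₀ (hs x hx)

lemma tendstoContDiffOn_univ [ProperSpace E] {k : ℕ} (hφ : ∀ n, ContDiff ℝ k (φ n))
    (hφ₀ : ContDiff ℝ k φ₀)
    (h : ∀ K : Set E, IsCompact K → ∀ i : ℕ, i ≤ k → TendstoUniformlyOn
      (fun n x => iteratedFDeriv ℝ i (φ n) x) (iteratedFDeriv ℝ i φ₀) l K) :
    TendstoContDiffOn k φ φ₀ l univ := by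
  refine ⟨fun n => (hφ n).contDiffOn, hφ₀.contDiffOn, fun i hi => ?_⟩
  simp only [iteratedFDerivWithin_univ]
  refine (tendstoLocallyUniformlyOn_iff_tendsto_prod
    (F := fun n x => iteratedFDeriv ℝ i (φ n) x)
    (hφ₀.continuous_iteratedFDeriv (mod_cast hi)).continuousOn).1 ?_
  rw [tendstoLocallyUniformlyOn_iff_forall_isCompact isOpen_univ]
  exact fun K _ hK => h K hK i hi

lemma TendstoContDiffOn.tendstoUniformlyOn_iteratedDerivWithin {φ : ι → ℝ → F} {φ₀ : ℝ → F}
    {s : Set ℝ} (h : TendstoContDiffOn j φ φ₀ l s) {i : ℕ} (hi : i ≤ j) (hs : IsCompact s)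
    (hus : UniqueDiffOn ℝ s) :
    TendstoUniformlyOn (fun n => iteratedDerivWithin i (φ n) s) (iteratedDerivWithin i φ₀ s)
      l s := by
  rw [← tendstoLocallyUniformlyOn_iff_tendstoUniformlyOn_of_compact hs,
    tendstoLocallyUniformlyOn_iff_tendsto_prod
      (h.2.1.continuousOn_iteratedDerivWithin (mod_cast hi) hus)]
  intro x hx
  exact ((ContinuousMultilinearMap.apply ℝ (fun _ : Fin i => ℝ) F (fun _ => 1)).continuous.tendsto
    _).comp (h.2.2 i hi x hx)

end ContDiffConvergence

/-! ### Constant speed curves in level sets of planar functions -/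

section LevelCurve

/-- The unit vector obtained from the gradient of a linear form by a positive quarter turn. -/
noncomputable def unitTangent (w : ℝ × ℝ →L[ℝ] ℝ) : ℝ × ℝ :=
  (√(w (1, 0) ^ 2 + w (0, 1) ^ 2))⁻¹ • (-w (0, 1), w (1, 0))

/-- The composition of a linear form with a negative quarter turn. -/
noncomputable def rotatedForm (w : ℝ × ℝ →L[ℝ] ℝ) : ℝ × ℝ →L[ℝ] ℝ :=
  w (1, 0) • ContinuousLinearMap.snd ℝ ℝ ℝ - w (0, 1) • ContinuousLinearMap.fst ℝ ℝ ℝ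

variable {w : ℝ × ℝ →L[ℝ] ℝ}

lemma apply_eq_fst_snd (w : ℝ × ℝ →L[ℝ] ℝ) (v : ℝ × ℝ) :
    w v = v.1 * w (1, 0) + v.2 * w (0, 1) := by
  have h : v = v.1 • ((1 : ℝ), (0 : ℝ)) + v.2 • ((0 : ℝ), (1 : ℝ)) := by ext <;> simp
  conv_lhs => rw [h]
  simp only [map_add, map_smul, smul_eq_mul]

@[simp]
lemma rotatedForm_apply (w : ℝ × ℝ →L[ℝ] ℝ) (v : ℝ × ℝ) :
    rotatedForm w v = w (1, 0) * v.2 - w (0, 1) * v.1 := rfl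

lemma sq_add_sq_pos_of_ne_zero (hw : w ≠ 0) : 0 < w (1, 0) ^ 2 + w (0, 1) ^ 2 := by
  by_contra! h
  apply hw
  have h1 : w (1, 0) = 0 := by nlinarith [sq_nonneg (w (1, 0)), sq_nonneg (w (0, 1))]
  have h2 : w (0, 1) = 0 := by nlinarith [sq_nonneg (w (1, 0)), sq_nonneg (w (0, 1))]
  ext <;> simp [h1, h2]

lemma unitTangent_sq_add_sq (hw : w ≠ 0) :
    (unitTangent w).1 ^ 2 + (unitTangent w).2 ^ 2 = 1 := by
  have h := sq_add_sq_pos_of_ne_zero hw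
  have h' := Real.sq_sqrt h.le
  have h'' := Real.sqrt_pos.2 h
  simp only [unitTangent, Prod.smul_mk, smul_eq_mul]
  field_simp
  linarith

lemma norm_unitTangent_le (w : ℝ × ℝ →L[ℝ] ℝ) : ‖unitTangent w‖ ≤ 1 := by
  by_cases hw : w = 0
  · simp [unitTangent, hw]
  · have h := unitTangent_sq_add_sq hw
    rw [Prod.norm_def, Real.norm_eq_abs, Real.norm_eq_abs, max_le_iff]
    constructor <;> apply abs_le_of_sq_le_sq _ zero_le_one <;>
      nlinarith [sq_nonneg (unitTangent w).1, sq_nonneg (unitTangent w).2]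

lemma rotatedForm_unitTangent_pos (hw : w ≠ 0) : 0 < rotatedForm w (unitTangent w) := by
  have h := sq_add_sq_pos_of_ne_zero hw
  have h'' := Real.sqrt_pos.2 h
  have : rotatedForm w (unitTangent w) =
      (√(w (1, 0) ^ 2 + w (0, 1) ^ 2))⁻¹ * (w (1, 0) ^ 2 + w (0, 1) ^ 2) := by
    simp only [rotatedForm_apply, unitTangent, Prod.smul_mk, smul_eq_mul]
    ring
  rw [this]
  positivity

lemma eq_zero_of_rotatedForm_eq_zero (hw : w ≠ 0) {v : ℝ × ℝ} (h : w v = 0)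
    (h' : rotatedForm w v = 0) : v = 0 := by
  have hpos := sq_add_sq_pos_of_ne_zero hw
  rw [rotatedForm_apply] at h'
  rw [apply_eq_fst_snd] at h
  ext
  · have : (w (1, 0) ^ 2 + w (0, 1) ^ 2) * v.1 = 0 := by
      linear_combination w (1, 0) * h - w (0, 1) * h'
    simpa [hpos.ne'] using this
  · have : (w (1, 0) ^ 2 + w (0, 1) ^ 2) * v.2 = 0 := by
      linear_combination w (0, 1) * h + w (1, 0) * h'
    simpa [hpos.ne'] using this

lemma eq_smul_unitTangent (hw : w ≠ 0) {v : ℝ × ℝ} (h : w v = 0) :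
    v = (v.1 * (unitTangent w).1 + v.2 * (unitTangent w).2) • unitTangent w := by
  have hpos := sq_add_sq_pos_of_ne_zero hw
  have h' := Real.sq_sqrt hpos.le
  have h'' := Real.sqrt_pos.2 hpos
  rw [apply_eq_fst_snd] at h
  simp only [unitTangent, Prod.smul_mk, smul_eq_mul]
  ext
  · simp only
    field_simp
    rw [h']
    linear_combination w (1, 0) * h
  · simp only
    field_simp
    rw [h']
    linear_combination w (0, 1) * h

lemma contDiffOn_unitTangent {n : ℕ∞ω} : ContDiffOn ℝ n unitTangent {w | w ≠ 0} := by
  have h : ∀ v : ℝ × ℝ, ContDiff ℝ n fun w : ℝ × ℝ →L[ℝ] ℝ => w v := fun v =>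
    (ContinuousLinearMap.apply ℝ ℝ v).contDiff
  have h1 : ContDiff ℝ n fun w : ℝ × ℝ →L[ℝ] ℝ => w (1, 0) ^ 2 + w (0, 1) ^ 2 :=
    ((h _).pow 2).add ((h _).pow 2)
  refine ContDiffOn.smul (ContDiffOn.inv (h1.contDiffOn.sqrt fun w hw => ?_) fun w hw => ?_)
    ((h _).neg.prodMk (h _)).contDiffOn
  · exact (sq_add_sq_pos_of_ne_zero hw).ne'
  · exact (Real.sqrt_pos.2 (sq_add_sq_pos_of_ne_zero hw)).ne'

lemma continuousAt_unitTangent (hw : w ≠ 0) : ContinuousAt unitTangent w :=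
  (contDiffOn_unitTangent (n := 0)).continuousOn.continuousAt (isOpen_ne.mem_nhds hw)

/-- The curve `φ` runs on `[0, S]` in the level set `{f = 1}` with signed speed `a`. -/
def IsLevelCurve (f : ℝ × ℝ → ℝ) (a : ℝ) (φ : ℝ → ℝ × ℝ) (S : ℝ) : Prop :=
  ∀ t ∈ Icc 0 S, f (φ t) = 1 ∧
    HasDerivWithinAt φ (a • unitTangent (fderiv ℝ f (φ t))) (Icc 0 S) t

variable {f : ℝ × ℝ → ℝ} {a S : ℝ} {φ ψ : ℝ → ℝ × ℝ}

lemma IsLevelCurve.norm_sub_le (h : IsLevelCurve f a φ S) {s t : ℝ} (hs : s ∈ Icc 0 S)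
    (ht : t ∈ Icc 0 S) : ‖φ t - φ s‖ ≤ |a| * |t - s| := by
  refine Convex.norm_image_sub_le_of_norm_hasDerivWithin_le (fun x hx => (h x hx).2)
    (fun x _ => ?_) (convex_Icc 0 S) hs ht
  rw [norm_smul, Real.norm_eq_abs]
  exact mul_le_of_le_one_right (abs_nonneg a) (norm_unitTangent_le _)

lemma IsLevelCurve.continuousOn (h : IsLevelCurve f a φ S) : ContinuousOn φ (Icc 0 S) :=
  fun t ht => (h t ht).2.continuousWithinAt

lemma IsLevelCurve.comp_affine (h : IsLevelCurve f a φ S) (r d T : ℝ)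
    (hT : ∀ t ∈ Icc 0 T, r * t + d ∈ Icc 0 S) :
    IsLevelCurve f (a * r) (fun t => φ (r * t + d)) T := by
  intro t ht
  refine ⟨(h _ (hT t ht)).1, ?_⟩
  have h1 : HasDerivWithinAt (fun t : ℝ => r * t + d) r (Icc 0 T) t := by
    simpa using (((hasDerivAt_id t).const_mul r).add_const d).hasDerivWithinAt
  have := (h _ (hT t ht)).2.scomp t h1 hT
  rwa [smul_smul, mul_comm r a] at this

/-- Near a regular point there is a function measuring time along the level curves. -/
lemma exists_time_function (hf : ContDiff ℝ 1 f) {p : ℝ × ℝ} (hp : fderiv ℝ f p ≠ 0) :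
    ∃ (θ : ℝ × ℝ → ℝ) (θ' : ℝ × ℝ → ℝ × ℝ →L[ℝ] ℝ), ∃ V ∈ 𝓝 p,
      InjOn θ (V ∩ {v | f v = f p}) ∧ ∀ v ∈ V, f v = f p →
        HasFDerivAt θ (θ' v) v ∧ θ' v (unitTangent (fderiv ℝ f v)) = 1 := by
  set w := fderiv ℝ f p with hw
  set L := rotatedForm w with hL
  -- the local chart `v ↦ (L v, f v)`
  let A : ℝ × ℝ →L[ℝ] ℝ × ℝ := L.prod w
  have hAinj : Function.Injective A := by
    refine (injective_iff_map_eq_zero A).2 fun v hv => ?_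
    have h1 : L v = 0 := congrArg Prod.fst hv
    have h2 : w v = 0 := congrArg Prod.snd hv
    exact eq_zero_of_rotatedForm_eq_zero hp h2 h1
  let A' : (ℝ × ℝ) ≃L[ℝ] ℝ × ℝ :=
    (LinearEquiv.ofInjectiveEndo A.toLinearMap hAinj).toContinuousLinearEquiv
  have hstrict : HasStrictFDerivAt (fun v => (L v, f v)) (A' : ℝ × ℝ →L[ℝ] ℝ × ℝ) p := by
    have h1 : HasStrictFDerivAt (fun v => (L v, f v)) A p :=
      L.hasStrictFDerivAt.prodMk (hf.contDiffAt.hasStrictFDerivAt one_ne_zero)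
    convert h1 using 1
    exact ContinuousLinearMap.ext fun v => rfl
  let e := hstrict.toOpenPartialHomeomorph (fun v => (L v, f v))
  have he : ∀ v, e v = (L v, f v) := fun v => rfl
  have hpe : p ∈ e.source := hstrict.mem_toOpenPartialHomeomorph_source
  set x₀ := L p with hx₀
  have hsymm : e.symm (x₀, f p) = p := e.left_inv hpe
  have htarget : (x₀, f p) ∈ e.target := e.map_source hpe
  -- the velocity of the coordinate `L`
  let h : ℝ × ℝ → ℝ := fun v => L (unitTangent (fderiv ℝ f v))
  have hcont : ∀ v, fderiv ℝ f v ≠ 0 → ContinuousAt h v := fun v hv =>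
    L.continuous.continuousAt.comp
      ((continuousAt_unitTangent hv).comp (hf.continuous_fderiv one_ne_zero).continuousAt)
  have hp0 : 0 < h p := rotatedForm_unitTangent_pos hp
  have hgood : ∀ᶠ v in 𝓝 p, fderiv ℝ f v ≠ 0 ∧ 0 < h v :=
    ((hf.continuous_fderiv one_ne_zero).continuousAt.eventually_ne hp).and
      ((hcont p hp).eventually (lt_mem_nhds hp0))
  have hline : ContinuousAt (fun x : ℝ => (x, f p)) x₀ := by fun_prop
  have hsymmc : Tendsto (fun x : ℝ => e.symm (x, f p)) (𝓝 x₀) (𝓝 p) := by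
    have := (e.continuousAt_symm htarget).tendsto.comp hline.tendsto
    rwa [hsymm] at this
  have hev : ∀ᶠ x in 𝓝 x₀, (x, f p) ∈ e.target ∧
      (fderiv ℝ f (e.symm (x, f p)) ≠ 0 ∧ 0 < h (e.symm (x, f p))) :=
    (hline.eventually (e.open_target.mem_nhds htarget)).and (hsymmc.eventually hgood)
  obtain ⟨r, hr, hball⟩ := Metric.nhds_basis_closedBall.mem_iff.1 hev
  rw [Real.closedBall_eq_Icc] at hball
  have hle : x₀ - r ≤ x₀ + r := by linarith
  let H : ℝ → ℝ := IccExtend hle fun x => h (e.symm (x, f p))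
  have hHcont : Continuous H := by
    suffices hon : ContinuousOn (fun x => h (e.symm (x, f p))) (Icc (x₀ - r) (x₀ + r)) from
      (continuousOn_iff_continuous_domRestrict.1 hon).Icc_extend'
    refine fun x hx => ContinuousAt.continuousWithinAt ?_
    have hx' := hball hx
    refine ContinuousAt.comp (f := fun x => e.symm (x, f p)) (hcont _ hx'.2.1) ?_
    exact ContinuousAt.comp (f := fun x => (x, f p)) (e.continuousAt_symm hx'.1) (by fun_prop)
  have hHpos : ∀ x, 0 < H x := fun x => (hball (projIcc _ _ hle x).2).2.2
  have hHinv : Continuous fun x => (H x)⁻¹ := hHcont.inv₀ fun x => (hHpos x).ne'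
  let Φ : ℝ → ℝ := fun x => ∫ y in x₀..x, (H y)⁻¹
  have hΦ : ∀ x, HasDerivAt Φ (H x)⁻¹ x := fun x =>
    hHinv.integral_hasStrictDerivAt x₀ x |>.hasDerivAt
  have hΦmono : StrictMono Φ := strictMono_of_hasDerivAt_pos hΦ fun x => inv_pos.2 (hHpos x)
  refine ⟨fun v => Φ (L v), fun v => (H (L v))⁻¹ • L, e.source ∩ L ⁻¹' Icc (x₀ - r) (x₀ + r),
    inter_mem (e.open_source.mem_nhds hpe) (L.continuous.continuousAt.preimage_mem_nhds
      (Icc_mem_nhds (by linarith) (by linarith))), ?_, ?_⟩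
  · rintro v ⟨⟨hv, -⟩, hvf⟩ v' ⟨⟨hv', -⟩, hvf'⟩ heq
    refine e.injOn hv hv' ?_
    rw [he, he, hΦmono.injective heq, mem_ofPred.1 hvf, mem_ofPred.1 hvf']
  · rintro v ⟨hv, hvL⟩ hvf
    refine ⟨(hΦ (L v)).comp_hasFDerivAt v L.hasFDerivAt, ?_⟩
    have h1 : H (L v) = h v := by
      have : e.symm (L v, f p) = v := by rw [← hvf]; exact e.left_inv hv
      simp only [H, IccExtend_of_mem hle _ hvL, this]
    have h2 := hHpos (L v)
    simp only [smul_apply, smul_eq_mul]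
    change (H (L v))⁻¹ * h v = 1
    rw [← h1, inv_mul_cancel₀ h2.ne']

/-- Uniqueness of constant speed curves in a regular level set. -/
lemma IsLevelCurve.eqOn (hf : ContDiff ℝ 1 f) (hreg : ∀ v, f v = 1 → fderiv ℝ f v ≠ 0)
    (hφ : IsLevelCurve f a φ S) (hψ : IsLevelCurve f a ψ S) (h0 : φ 0 = ψ 0) :
    EqOn φ ψ (Icc 0 S) := by
  have hclosed : IsClosed ({t | φ t = ψ t} ∩ Icc 0 S) := by
    have := (hφ.continuousOn.sub hψ.continuousOn).preimage_isClosed_of_isClosed isClosed_Icc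
      (isClosed_singleton (x := (0 : ℝ × ℝ)))
    rw [inter_comm]
    convert this using 2
    ext t
    simp [sub_eq_zero]
  refine hclosed.Icc_subset_of_forall_mem_nhdsWithin h0 ?_
  rintro t₀ ⟨ht₀ : φ t₀ = ψ t₀, ht₀S⟩
  have hmem : t₀ ∈ Icc 0 S := Ico_subset_Icc_self ht₀S
  obtain ⟨θ, θ', V, hV, hinj, hθ⟩ := exists_time_function hf (hreg _ (hφ t₀ hmem).1)
  rw [(hφ t₀ hmem).1] at hinj hθ
  have hφV : ∀ᶠ t in 𝓝[Icc 0 S] t₀, φ t ∈ V := (hφ.continuousOn t₀ hmem).eventually hV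
  have hψV : ∀ᶠ t in 𝓝[Icc 0 S] t₀, ψ t ∈ V :=
    (hψ.continuousOn t₀ hmem).eventually (by rwa [← ht₀])
  obtain ⟨δ, hδ, hball⟩ := Metric.mem_nhdsWithin_iff.1 (hφV.and hψV)
  have hsub : Icc t₀ (min S (t₀ + δ / 2)) ⊆ Metric.ball t₀ δ ∩ Icc 0 S := by
    intro t ht
    have h1 := ht.2.trans (min_le_left _ _)
    have h2 := ht.2.trans (min_le_right _ _)
    refine ⟨?_, hmem.1.trans ht.1, h1⟩
    rw [Metric.mem_ball, Real.dist_eq, abs_lt]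
    constructor <;> linarith [ht.1]
  have hlt : t₀ < min S (t₀ + δ / 2) := lt_min ht₀S.2 (by linarith)
  refine mem_of_superset (Ioc_mem_nhdsGT hlt) fun t ht => ?_
  have ht' := Ioc_subset_Icc_self ht
  have hder : ∀ χ : ℝ → ℝ × ℝ, IsLevelCurve f a χ S →
      (∀ t ∈ Icc t₀ (min S (t₀ + δ / 2)), χ t ∈ V) → ∀ t ∈ Icc t₀ (min S (t₀ + δ / 2)),
      HasDerivWithinAt (fun t => θ (χ t)) a (Icc t₀ (min S (t₀ + δ / 2))) t := by
    intro χ hχ hχV t ht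
    obtain ⟨hfχ, hχ'⟩ := hχ t (hsub ht).2
    obtain ⟨h1, h2⟩ := hθ _ (hχV t ht) hfχ
    have := h1.comp_hasDerivWithinAt t (hχ'.mono fun t ht => (hsub ht).2)
    rwa [map_smul, h2, smul_eq_mul, mul_one] at this
  have hφθ := hder φ hφ fun t ht => (hball (hsub ht)).1
  have hψθ := hder ψ hψ fun t ht => (hball (hsub ht)).2
  have hconst := Convex.norm_image_sub_le_of_norm_hasDerivWithin_le (C := 0)
    (fun t ht => (hφθ t ht).sub (hψθ t ht)) (by simp) (convex_Icc _ _)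
    (left_mem_Icc.2 hlt.le) ht'
  simp only [Pi.sub_apply, ht₀, sub_self, sub_zero, zero_mul, norm_le_zero_iff, sub_eq_zero]
    at hconst
  exact hinj ⟨(hball (hsub ht')).1, (hφ t (hsub ht').2).1⟩
    ⟨(hball (hsub ht')).2, (hψ t (hsub ht').2).1⟩ hconst

variable {ι : Type} {F : ι → ℝ × ℝ → ℝ} {l : Filter ι}

lemma TendstoContDiffOn.tendsto_univ (h : TendstoContDiffOn 1 F f l univ) (p : ℝ × ℝ) :
    Tendsto (fun q : ι × (ℝ × ℝ) => F q.1 q.2) (l ×ˢ 𝓝 p) (𝓝 (f p)) := by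
  simpa only [nhdsWithin_univ] using h.tendsto (mem_univ p)

lemma TendstoContDiffOn.tendsto_fderiv (h : TendstoContDiffOn 1 F f l univ) (p : ℝ × ℝ) :
    Tendsto (fun q : ι × (ℝ × ℝ) => fderiv ℝ (F q.1) q.2) (l ×ˢ 𝓝 p) (𝓝 (fderiv ℝ f p)) := by
  have := ((tendstoContDiffOn_succ_iff uniqueDiffOn_univ).1 h).2.2.2.tendsto (mem_univ p)
  simpa only [nhdsWithin_univ, fderivWithin_univ] using this

lemma TendstoContDiffOn.tendsto_unitTangent (h : TendstoContDiffOn 1 F f l univ) {p : ℝ × ℝ}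
    (hp : fderiv ℝ f p ≠ 0) :
    Tendsto (fun q : ι × (ℝ × ℝ) => unitTangent (fderiv ℝ (F q.1) q.2)) (l ×ˢ 𝓝 p)
      (𝓝 (unitTangent (fderiv ℝ f p))) :=
  (continuousAt_unitTangent hp).tendsto.comp (h.tendsto_fderiv p)

/-- Compactness: along an ultrafilter, level curves converge to a level curve of the limit. -/
lemma exists_isLevelCurve_tendsto {U : Ultrafilter ι} (h : TendstoContDiffOn 1 F f U univ)
    (hreg : ∀ v, f v = 1 → fderiv ℝ f v ≠ 0) {φ : ι → ℝ → ℝ × ℝ} {a : ι → ℝ} {a₀ : ℝ}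
    {p : ℝ × ℝ} (hS : 0 ≤ S) (ha : Tendsto a U (𝓝 a₀))
    (hφ : ∀ᶠ n in (U : Filter ι), IsLevelCurve (F n) (a n) (φ n) S)
    (h0 : Tendsto (fun n => φ n 0) U (𝓝 p)) :
    ∃ χ, IsLevelCurve f a₀ χ S ∧ χ 0 = p ∧
      ∀ t ∈ Icc 0 S, Tendsto (fun n => φ n t) U (𝓝 (χ t)) := by
  have h0S : (0 : ℝ) ∈ Icc 0 S := left_mem_Icc.2 hS
  have hM : ∀ᶠ n in (U : Filter ι), |a n| ≤ |a₀| + 1 :=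
    (ha.abs.eventually (gt_mem_nhds (lt_add_one |a₀|))).mono fun n hn => hn.le
  have hlim : ∀ t ∈ Icc 0 S, ∃ q, Tendsto (fun n => φ n t) U (𝓝 q) := by
    intro t ht
    have hb : ∀ᶠ n in (U : Filter ι), φ n t ∈ Metric.closedBall p ((|a₀| + 1) * S + 1) := by
      filter_upwards [hφ, hM, h0.eventually (Metric.closedBall_mem_nhds p zero_lt_one)]
        with n hn hMn hn0
      have h1 : ‖φ n t - φ n 0‖ ≤ (|a₀| + 1) * S := by
        refine (hn.norm_sub_le h0S ht).trans (mul_le_mul hMn ?_ (abs_nonneg _) (by positivity))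
        rw [sub_zero, abs_of_nonneg ht.1]
        exact ht.2
      rw [← dist_eq_norm] at h1
      exact (dist_triangle _ (φ n 0) _).trans (add_le_add h1 hn0)
    obtain ⟨q, -, hq⟩ := (isCompact_closedBall p ((|a₀| + 1) * S + 1)).ultrafilter_le_nhds
      (U.map fun n => φ n t) (le_principal_iff.2 hb)
    exact ⟨q, hq⟩
  choose! χ hχ using hlim
  have hfχ : ∀ t ∈ Icc 0 S, f (χ t) = 1 := by
    intro t ht
    have h1 : Tendsto (fun n => F n (φ n t)) U (𝓝 (f (χ t))) :=
      (h.tendsto_univ (χ t)).comp (tendsto_id.prodMk (hχ t ht))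
    refine tendsto_nhds_unique h1 (tendsto_const_nhds.congr' ?_)
    filter_upwards [hφ] with n hn using (hn t ht).1.symm
  refine ⟨χ, fun t ht => ⟨hfχ t ht, ?_⟩, tendsto_nhds_unique (hχ 0 h0S) h0, hχ⟩
  set X := a₀ • unitTangent (fderiv ℝ f (χ t)) with hX
  have hvel : Tendsto (fun q : ι × (ℝ × ℝ) => a q.1 • unitTangent (fderiv ℝ (F q.1) q.2))
      (U ×ˢ 𝓝 (χ t)) (𝓝 X) :=
    (ha.comp tendsto_fst).smul (h.tendsto_unitTangent (hreg _ (hfχ t ht)))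
  rw [hasDerivWithinAt_iff_isLittleO, Asymptotics.isLittleO_iff]
  intro ε hε
  obtain ⟨P, hP, Q, hQ, hPQ⟩ := eventually_prod_iff.1
    (hvel.eventually (Metric.closedBall_mem_nhds X hε))
  obtain ⟨δ, hδ, hball⟩ := Metric.eventually_nhds_iff_ball.1 hQ
  set η := δ / (2 * (|a₀| + 1)) with hη
  have hη0 : 0 < η := by positivity
  filter_upwards [inter_mem_nhdsWithin (Icc 0 S) (Metric.ball_mem_nhds t hη0)] with s hs
  have hbound : ∀ᶠ n in (U : Filter ι), ‖φ n s - φ n t - (s - t) • X‖ ≤ ε * ‖s - t‖ := by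
    filter_upwards [hφ, hM, hP, (hχ t ht).eventually (Metric.ball_mem_nhds _ (half_pos hδ))]
      with n hn hMn hPn hnt
    have hder : ∀ r ∈ Icc 0 S ∩ Metric.ball t η, HasDerivWithinAt (fun r => φ n r - r • X)
        (a n • unitTangent (fderiv ℝ (F n) (φ n r)) - X) (Icc 0 S ∩ Metric.ball t η) r := by
      intro r hr
      have h1 := ((hn r hr.1).2.mono inter_subset_left).sub
        (((hasDerivAt_id r).smul_const X).hasDerivWithinAt (s := Icc 0 S ∩ Metric.ball t η))
      rw [one_smul] at h1
      exact h1
    have := Convex.norm_image_sub_le_of_norm_hasDerivWithin_le (C := ε) hder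
      (fun r hr => ?_) ((convex_Icc 0 S).inter (convex_ball t η)) ⟨ht, Metric.mem_ball_self hη0⟩ hs
    · convert this using 1
      congr 1
      module
    · rw [← dist_eq_norm]
      refine hPQ hPn (hball _ ?_)
      have h1 : dist (φ n r) (φ n t) ≤ δ / 2 := by
        rw [dist_eq_norm]
        refine (hn.norm_sub_le ht hr.1).trans ?_
        have h2 : |r - t| ≤ η := (Metric.mem_ball.1 hr.2).le
        calc |a n| * |r - t| ≤ (|a₀| + 1) * η := by gcongr
          _ = δ / 2 := by rw [hη]; field_simp
      have h3 := dist_triangle (φ n r) (φ n t) (χ t)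
      exact Metric.mem_ball.2 (by linarith [Metric.mem_ball.1 hnt])
  exact le_of_tendsto ((((hχ s hs.1).sub (hχ t ht)).sub_const _).norm) hbound

/-- Continuous dependence of level curves on the function, the speed and the initial point. -/
lemma tendsto_levelCurve (h : TendstoContDiffOn 1 F f l univ)
    (hreg : ∀ v, f v = 1 → fderiv ℝ f v ≠ 0) {φ : ι → ℝ → ℝ × ℝ} {a : ι → ℝ} {a₀ : ℝ}
    (ha : Tendsto a l (𝓝 a₀)) (hφ : ∀ᶠ n in l, IsLevelCurve (F n) (a n) (φ n) S)
    (hψ : IsLevelCurve f a₀ ψ S) (h0 : Tendsto (fun n => φ n 0) l (𝓝 (ψ 0))) :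
    ∀ t ∈ Icc 0 S, Tendsto (fun q : ι × ℝ => φ q.1 q.2) (l ×ˢ 𝓝[Icc 0 S] t) (𝓝 (ψ t)) := by
  intro t ht
  have hf : ContDiff ℝ 1 f := contDiffOn_univ.1 (by simpa using h.2.1)
  have hpt : Tendsto (fun n => φ n t) l (𝓝 (ψ t)) := by
    refine (tendsto_iff_ultrafilter _ _ _).2 fun U hU => ?_
    obtain ⟨χ, hχ, hχ0, hlim⟩ := exists_isLevelCurve_tendsto (h.mono_filter hU) hreg
      (ht.1.trans ht.2) (ha.mono_left hU) (hφ.filter_mono hU) (h0.mono_left hU)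
    rw [← hχ.eqOn hf hreg hψ hχ0 ht]
    exact hlim t ht
  have hM : ∀ᶠ n in l, |a n| ≤ |a₀| + 1 :=
    (ha.abs.eventually (gt_mem_nhds (lt_add_one |a₀|))).mono fun n hn => hn.le
  have hdiff : Tendsto (fun q : ι × ℝ => φ q.1 q.2 - φ q.1 t) (l ×ˢ 𝓝[Icc 0 S] t) (𝓝 0) := by
    have hz : Tendsto (fun q : ι × ℝ => (|a₀| + 1) * |q.2 - t|) (l ×ˢ 𝓝[Icc 0 S] t) (𝓝 0) := by
      have : Tendsto (fun s : ℝ => (|a₀| + 1) * |s - t|) (𝓝 t) (𝓝 ((|a₀| + 1) * |t - t|)) :=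
        Continuous.tendsto (by fun_prop) t
      rw [sub_self, abs_zero, mul_zero] at this
      exact (this.mono_left nhdsWithin_le_nhds).comp tendsto_snd
    refine squeeze_zero_norm' ?_ hz
    filter_upwards [tendsto_fst.eventually (hφ.and hM), eventually_snd_mem_prod_nhdsWithin t]
      with q hq hqS
    exact (hq.1.norm_sub_le ht hqS).trans (by gcongr; exact hq.2)
  simpa using hdiff.add (hpt.comp tendsto_fst)

/-- Near a regular point, level curves are graphs over their tangent line, uniformly in `F`. -/
lemma TendstoContDiffOn.eventually_eq_of_rotatedForm_eq (h : TendstoContDiffOn 1 F f l univ)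
    {p : ℝ × ℝ} (hp : fderiv ℝ f p ≠ 0) :
    ∃ V ∈ 𝓝 p, ∀ᶠ n in l, ∀ v ∈ V, ∀ v' ∈ V, F n v = F n v' →
      rotatedForm (fderiv ℝ f p) v = rotatedForm (fderiv ℝ f p) v' → v = v' := by
  set w := fderiv ℝ f p with hw
  set e : ℝ × ℝ := (w (1, 0), w (0, 1)) with he
  have hpos : 0 < w e := by
    have := sq_add_sq_pos_of_ne_zero hp
    rw [apply_eq_fst_snd]
    simp only [he]
    linarith
  have hev : ∀ᶠ q in l ×ˢ 𝓝 p, 0 < fderiv ℝ (F q.1) q.2 e :=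
    (((ContinuousLinearMap.apply ℝ ℝ e).continuous.tendsto w).comp
      (h.tendsto_fderiv p)).eventually (lt_mem_nhds hpos)
  obtain ⟨P, hP, Q, hQ, hPQ⟩ := eventually_prod_iff.1 hev
  obtain ⟨δ, hδ, hball⟩ := Metric.eventually_nhds_iff_ball.1 hQ
  refine ⟨Metric.ball p δ, Metric.ball_mem_nhds p hδ, hP.mono fun n hn v hv v' hv' hF hR => ?_⟩
  have hFn : Differentiable ℝ (F n) := fun x =>
    ((h.1 n).differentiableOn (by simp) x (mem_univ x)).differentiableAt univ_mem
  obtain ⟨z, hz, hz'⟩ := domain_mvt (fun x _ => (hFn x).hasFDerivAt.hasFDerivWithinAt)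
    (convex_ball p δ) hv' hv
  have hzb : z ∈ Metric.ball p δ := (convex_ball p δ).segment_subset hv' hv hz
  have hzpos := hPQ hn (hball z hzb)
  rw [hF, sub_self] at hz'
  have hR' : rotatedForm w (v - v') = 0 := by rw [map_sub, hR, sub_self]
  have hsq := sq_add_sq_pos_of_ne_zero hp
  have hdisp : v - v' = (w (v - v') / (w (1, 0) ^ 2 + w (0, 1) ^ 2)) • e := by
    rw [rotatedForm_apply] at hR'
    rw [apply_eq_fst_snd w (v - v')]
    ext
    · simp only [he, Prod.smul_mk, smul_eq_mul]
      field_simp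
      linear_combination -w (0, 1) * hR'
    · simp only [he, Prod.smul_mk, smul_eq_mul]
      field_simp
      linear_combination w (1, 0) * hR'
  rw [hdisp, map_smul, smul_eq_mul, eq_comm, mul_eq_zero, or_iff_left hzpos.ne'] at hz'
  rw [hz', zero_smul, sub_eq_zero] at hdisp
  exact hdisp

lemma IsLevelCurve.mono (h : IsLevelCurve f a φ S) {T : ℝ} (hT : T ≤ S) :
    IsLevelCurve f a φ T := fun t ht =>
  ⟨(h t (Icc_subset_Icc_right hT ht)).1,
    (h t (Icc_subset_Icc_right hT ht)).2.mono (Icc_subset_Icc_right hT)⟩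

lemma tendsto_apply_of_tendsto_prod {Φ : ι × ℝ → ℝ × ℝ} {s : Set ℝ} {t : ℝ} {p : ℝ × ℝ}
    (h : Tendsto Φ (l ×ˢ 𝓝[s] t) (𝓝 p)) (ht : t ∈ s) :
    Tendsto (fun n => Φ (n, t)) l (𝓝 p) :=
  h.comp (tendsto_id.prodMk (tendsto_const_pure.mono_right (pure_le_nhdsWithin ht)))

/-- Level curves which are injective on a period cannot turn around the limit curve more than
once. -/
lemma not_eventually_one_add_le_div [l.NeBot] (h : TendstoContDiffOn 1 F f l univ)
    (hreg : ∀ v, f v = 1 → fderiv ℝ f v ≠ 0) {φ : ι → ℝ → ℝ × ℝ} {b : ι → ℝ} {ε : ℝ}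
    (hε : 0 < ε) (hε1 : ε < 1 / 2) (ha : a ≠ 0) (hψ : IsLevelCurve f a ψ 1) (hψc : ψ 0 = ψ 1)
    (hφ : ∀ n, IsLevelCurve (F n) (b n) (φ n) 1) (hinj : ∀ n, InjOn (φ n) (Ico 0 1))
    (h0 : Tendsto (fun n => φ n 0) l (𝓝 (ψ 0))) :
    ¬ ∀ᶠ n in l, 1 + 2 * ε ≤ b n / a := by
  intro hb
  set r : ι → ℝ := fun n => a / b n with hr
  have hrpos : ∀ᶠ n in l, 0 < r n ∧ r n * (1 + 2 * ε) ≤ 1 ∧ b n * r n = a := by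
    filter_upwards [hb] with n hn
    have h1 : 0 < b n / a := by linarith
    have hbn : b n ≠ 0 := fun h => by simp [h] at h1
    have h2 : r n = (b n / a)⁻¹ := by rw [inv_div]
    refine ⟨h2 ▸ inv_pos.2 h1, ?_, by simp only [hr]; field_simp⟩
    rw [h2, inv_mul_le_iff₀ h1]
    linarith
  have hcurve : ∀ T d : ℝ, 0 ≤ d → T + d ≤ 1 + 2 * ε → ∀ᶠ n in l,
      IsLevelCurve (F n) a (fun t => φ n (r n * t + r n * d)) T := by
    intro T d hd hTd
    filter_upwards [hrpos] with n hn
    have := (hφ n).comp_affine (r n) (r n * d) T fun t ht => ?_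
    · rwa [hn.2.2] at this
    · rw [← mul_add]
      refine ⟨mul_nonneg hn.1.le (add_nonneg ht.1 hd), le_trans ?_ hn.2.1⟩
      exact mul_le_mul_of_nonneg_left (by linarith [ht.2]) hn.1.le
  have hlim1 := tendsto_levelCurve h hreg tendsto_const_nhds
    (hcurve 1 0 le_rfl (by linarith)) hψ (by simpa using h0)
  have hlim2 := tendsto_levelCurve h hreg tendsto_const_nhds
    (hcurve (2 * ε) 1 zero_le_one (by linarith)) (hψ.mono (by linarith)) (by
      rw [hψc]
      simpa using tendsto_apply_of_tendsto_prod (hlim1 1 (by simp)) (by simp))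
  have hε01 : ε ∈ Ioo (0 : ℝ) 1 := ⟨hε, by linarith⟩
  have hlate : Tendsto (fun n => φ n (r n * ε + r n * 1)) l (𝓝 (ψ ε)) :=
    tendsto_apply_of_tendsto_prod (hlim2 ε ⟨hε.le, by linarith⟩) ⟨hε.le, by linarith⟩
  obtain ⟨hfq, hψ'⟩ := hψ ε (Ioo_subset_Icc_self hε01)
  set w := fderiv ℝ f (ψ ε) with hw
  have hw0 : w ≠ 0 := hreg _ hfq
  obtain ⟨V, hV, hgraph⟩ := h.eventually_eq_of_rotatedForm_eq hw0
  -- the coordinate along the tangent line, oriented so that it increases along `ψ`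
  set L := a • rotatedForm w with hL
  have hLψ : HasDerivAt (fun s => L (ψ s) - L (ψ ε)) (L (a • unitTangent w)) ε :=
    (L.hasFDerivAt.comp_hasDerivAt ε
      (hψ'.hasDerivAt (Icc_mem_nhds hε01.1 hε01.2))).sub_const _
  have hLpos : 0 < deriv (fun s => L (ψ s) - L (ψ ε)) ε := by
    rw [hLψ.deriv]
    have := rotatedForm_unitTangent_pos hw0
    have h2 : L (a • unitTangent w) = a * a * rotatedForm w (unitTangent w) := by
      rw [hL, smul_apply, map_smul, smul_eq_mul, smul_eq_mul, mul_assoc]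
    rw [h2]
    exact mul_pos (mul_self_pos.2 ha) this
  have hsign := eventually_nhdsWithin_sign_eq_of_deriv_pos hLpos (by simp)
  obtain ⟨P, hP, Q, hQ, hPQ⟩ := eventually_prod_iff.1
    ((hlim1 ε (Ioo_subset_Icc_self hε01)).eventually hV)
  rw [nhdsWithin_eq_nhds.2 (Icc_mem_nhds hε01.1 hε01.2)] at hQ
  obtain ⟨δ, hδ, hball⟩ := Metric.nhds_basis_closedBall.mem_iff.1
    ((hsign.and hQ).and (Ioo_mem_nhds hε01.1 hε01.2))
  rw [Real.closedBall_eq_Icc] at hball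
  have hmem1 : ε - δ ∈ Icc (ε - δ) (ε + δ) := ⟨le_rfl, by linarith⟩
  have hmem2 : ε + δ ∈ Icc (ε - δ) (ε + δ) := ⟨by linarith, le_rfl⟩
  have hlt1 : L (ψ (ε - δ)) < L (ψ ε) := by
    have h1 := (hball hmem1).1.1
    rw [sign_neg (by linarith : ε - δ - ε < 0), sign_eq_neg_one_iff] at h1
    linarith
  have hlt2 : L (ψ ε) < L (ψ (ε + δ)) := by
    have h1 := (hball hmem2).1.1
    rw [sign_pos (by linarith : 0 < ε + δ - ε), sign_eq_one_iff] at h1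
    linarith
  have hLim : ∀ s ∈ Icc (ε - δ) (ε + δ),
      Tendsto (fun n => L (φ n (r n * s + r n * 0))) l (𝓝 (L (ψ s))) := fun s hs =>
    (L.continuous.tendsto _).comp (tendsto_apply_of_tendsto_prod
      (hlim1 s (Ioo_subset_Icc_self (hball hs).2)) (Ioo_subset_Icc_self (hball hs).2))
  have hLlate := (L.continuous.tendsto _).comp hlate
  obtain ⟨n, hrn, hcn, hPn, hVn, hgn, hn1, hn2⟩ := (hrpos.and ((hcurve 1 0 le_rfl
    (by linarith)).and (hP.and ((hlate.eventually hV).and (hgraph.and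
    (((hLim _ hmem1).eventually_lt hLlate hlt1).and
      (hLlate.eventually_lt (hLim _ hmem2) hlt2))))))).exists
  have hcont : ContinuousOn (fun s => L (φ n (r n * s + r n * 0))) (Icc (ε - δ) (ε + δ)) :=
    (L.continuous.comp_continuousOn hcn.continuousOn).mono fun s hs =>
      Ioo_subset_Icc_self (hball hs).2
  obtain ⟨s, hs, hsL⟩ := intermediate_value_Icc (by linarith : ε - δ ≤ ε + δ) hcont
    ⟨hn1.le, hn2.le⟩
  have hs01 := (hball hs).2
  have hlateIcc : r n * ε + r n * 1 ∈ Ico (0 : ℝ) 1 := by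
    have := mul_pos hrn.1 hε
    exact ⟨by linarith [hrn.1], by linarith [hrn.2.1]⟩
  have hearlyIcc : r n * s + r n * 0 ∈ Ico (0 : ℝ) 1 := by
    have h1 := mul_pos hrn.1 hs01.1
    have h2 := mul_lt_mul_of_pos_left hs01.2 hrn.1
    have h3 := mul_pos hrn.1 hε
    exact ⟨by linarith, by linarith [hrn.2.1]⟩
  have heq : φ n (r n * s + r n * 0) = φ n (r n * ε + r n * 1) := by
    refine hgn _ (hPQ hPn (hball hs).1.2) _ hVn ?_ ?_
    · rw [(hφ n _ (Ico_subset_Icc_self hlateIcc)).1, (hφ n _ (Ico_subset_Icc_self hearlyIcc)).1]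
    · simp only [hL, smul_apply, Function.comp_apply, smul_eq_mul] at hsL
      exact mul_left_cancel₀ ha hsL
  have := hinj n hearlyIcc hlateIcc heq
  rw [mul_zero, add_zero, ← mul_add] at this
  have := mul_left_cancel₀ hrn.1.ne' this
  linarith [hs01.2]

/-- The speeds of closed level curves do not tend to zero. -/
lemma not_tendsto_speed_zero [l.NeBot] (h : TendstoContDiffOn 1 F f l univ)
    {φ : ι → ℝ → ℝ × ℝ} {b : ι → ℝ} {p : ℝ × ℝ} (hp : fderiv ℝ f p ≠ 0)
    (hφ : ∀ n, IsLevelCurve (F n) (b n) (φ n) 1) (hb : ∀ n, b n ≠ 0)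
    (hclosed : ∀ n, φ n 0 = φ n 1) (h0 : Tendsto (fun n => φ n 0) l (𝓝 p)) :
    ¬ Tendsto b l (𝓝 0) := by
  intro hlim
  set L := rotatedForm (fderiv ℝ f p) with hL
  obtain ⟨P, hP, Q, hQ, hPQ⟩ := eventually_prod_iff.1
    (((L.continuous.tendsto _).comp (h.tendsto_unitTangent hp)).eventually
      (lt_mem_nhds (rotatedForm_unitTangent_pos hp)))
  obtain ⟨δ, hδ, hball⟩ := Metric.eventually_nhds_iff_ball.1 hQ
  have hb0 : ∀ᶠ n in l, |b n| < δ / 2 := by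
    have := hlim.abs
    rw [abs_zero] at this
    exact this.eventually (gt_mem_nhds (half_pos hδ))
  obtain ⟨n, hPn, hbn, hn0⟩ :=
    (hP.and (hb0.and (h0.eventually (Metric.ball_mem_nhds p (half_pos hδ))))).exists
  obtain ⟨t, ht, ht0⟩ := exists_hasDerivAt_eq_zero (f := fun t => L (φ n t))
    (f' := fun t => L (b n • unitTangent (fderiv ℝ (F n) (φ n t)))) zero_lt_one
    (L.continuous.comp_continuousOn (hφ n).continuousOn) (by simp only [hclosed n])
    fun t ht => L.hasFDerivAt.comp_hasDerivAt t
      ((hφ n t (Ioo_subset_Icc_self ht)).2.hasDerivAt (Icc_mem_nhds ht.1 ht.2))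
  rw [map_smul, smul_eq_mul, mul_eq_zero, or_iff_right (hb n)] at ht0
  refine (hPQ hPn (hball (φ n t) ?_)).ne' ht0
  have h1 := (hφ n).norm_sub_le (s := 0) (t := t) (by simp) (Ioo_subset_Icc_self ht)
  have h2 : |b n| * |t - 0| ≤ |b n| :=
    mul_le_of_le_one_right (abs_nonneg _) (by rw [sub_zero, abs_of_pos ht.1]; exact ht.2.le)
  rw [← dist_eq_norm] at h1
  have h3 := dist_triangle (φ n t) (φ n 0) p
  exact Metric.mem_ball.2 (by linarith [Metric.mem_ball.1 hn0])

/-- The density, with respect to arc length, of twice the area swept by the radius vector along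
the level curves of `f`. -/
noncomputable def areaDensity (f : ℝ × ℝ → ℝ) (v : ℝ × ℝ) : ℝ :=
  v.1 * (unitTangent (fderiv ℝ f v)).2 - v.2 * (unitTangent (fderiv ℝ f v)).1

lemma derivWithin_fst_eq {s : Set ℝ} {t : ℝ} {v : ℝ × ℝ} (h : HasDerivWithinAt φ v s t)
    (hs : UniqueDiffWithinAt ℝ s t) : derivWithin (fun x => (φ x).1) s t = v.1 :=
  ((hasFDerivAt_fst (p := φ t)).comp_hasDerivWithinAt t h).derivWithin hs

lemma derivWithin_snd_eq {s : Set ℝ} {t : ℝ} {v : ℝ × ℝ} (h : HasDerivWithinAt φ v s t)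
    (hs : UniqueDiffWithinAt ℝ s t) : derivWithin (fun x => (φ x).2) s t = v.2 :=
  ((hasFDerivAt_snd (p := φ t)).comp_hasDerivWithinAt t h).derivWithin hs

lemma IsLevelCurve.integral_areaDensity (h : IsLevelCurve f a φ 1) :
    ∫ t in (0 : ℝ)..1, ((φ t).1 * derivWithin (fun s => (φ s).2) (Icc 0 1) t -
      (φ t).2 * derivWithin (fun s => (φ s).1) (Icc 0 1) t) =
    ∫ t in (0 : ℝ)..1, a * areaDensity f (φ t) := by
  refine integral_congr fun t ht => ?_
  rw [uIcc_of_le zero_le_one] at ht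
  have hu := uniqueDiffOn_Icc (zero_lt_one (α := ℝ)) t ht
  have h1 := derivWithin_fst_eq (h t ht).2 hu
  have h2 := derivWithin_snd_eq (h t ht).2 hu
  simp only [h1, h2, areaDensity, Prod.smul_fst, Prod.smul_snd, smul_eq_mul]
  ring

lemma IsLevelCurve.reverse (h : IsLevelCurve f a φ S) :
    IsLevelCurve f (-a) (fun t => φ (S - t)) S := by
  convert h.comp_affine (-1) S S fun t ht => ⟨by linarith [ht.2], by linarith [ht.1]⟩ using 3
  · ring
  · ring

/-- A `C¹` curve of constant speed in a regular level set, sweeping a positive area, runs in the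
level set with constant signed speed. -/
lemma exists_isLevelCurve (hf : ContDiff ℝ 1 f) (hreg : ∀ v, f v = 1 → fderiv ℝ f v ≠ 0)
    (hφ : ContDiffOn ℝ 1 φ (Icc 0 1)) (hfφ : ∀ t ∈ Icc (0 : ℝ) 1, f (φ t) = 1)
    (hspeed : ∃ c : ℝ, ∀ t ∈ Icc (0 : ℝ) 1,
      √((derivWithin (fun s => (φ s).1) (Icc 0 1) t) ^ 2 +
        (derivWithin (fun s => (φ s).2) (Icc 0 1) t) ^ 2) = c)
    (horient : 0 < ∫ t in (0 : ℝ)..1, ((φ t).1 * derivWithin (fun s => (φ s).2) (Icc 0 1) t -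
      (φ t).2 * derivWithin (fun s => (φ s).1) (Icc 0 1) t)) :
    ∃ a, a ≠ 0 ∧ IsLevelCurve f a φ 1 := by
  obtain ⟨c, hc⟩ := hspeed
  have hud := uniqueDiffOn_Icc (zero_lt_one (α := ℝ))
  set d := derivWithin φ (Icc 0 1) with hd
  have hder : ∀ t ∈ Icc (0 : ℝ) 1, HasDerivWithinAt φ (d t) (Icc 0 1) t := fun t ht =>
    (hφ.differentiableOn one_ne_zero t ht).hasDerivWithinAt
  have hdcont : ContinuousOn d (Icc 0 1) := hφ.continuousOn_derivWithin hud le_rfl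
  set u : ℝ → ℝ × ℝ := fun t => unitTangent (fderiv ℝ f (φ t)) with hu
  have hucont : ContinuousOn u (Icc 0 1) :=
    (contDiffOn_unitTangent (n := 0)).continuousOn.comp
      ((hf.continuous_fderiv one_ne_zero).comp_continuousOn hφ.continuousOn)
      fun t ht => hreg _ (hfφ t ht)
  have hker : ∀ t ∈ Icc (0 : ℝ) 1, fderiv ℝ f (φ t) (d t) = 0 := fun t ht => by
    have h1 := ((hf.differentiable one_ne_zero (φ t)).hasFDerivAt).comp_hasDerivWithinAt t
      (hder t ht)
    have h2 : HasDerivWithinAt (f ∘ φ) 0 (Icc 0 1) t :=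
      (hasDerivWithinAt_const t (Icc 0 1) (1 : ℝ)).congr (fun s hs => hfφ s hs) (hfφ t ht)
    exact (hud t ht).eq_deriv _ h1 h2
  set α : ℝ → ℝ := fun t => (d t).1 * (u t).1 + (d t).2 * (u t).2 with hα
  have hdα : ∀ t ∈ Icc (0 : ℝ) 1, d t = α t • u t := fun t ht =>
    eq_smul_unitTangent (hreg _ (hfφ t ht)) (hker t ht)
  have hαcont : ContinuousOn α (Icc 0 1) :=
    (hdcont.fst.mul hucont.fst).add (hdcont.snd.mul hucont.snd)
  have hlevel : ∀ b, (∀ t ∈ Icc (0 : ℝ) 1, α t = b) → IsLevelCurve f b φ 1 := fun b hb t ht =>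
    ⟨hfφ t ht, by simpa only [hdα t ht, hb t ht] using hder t ht⟩
  have hne : ∀ b, IsLevelCurve f b φ 1 → b ≠ 0 := by
    rintro _ h rfl
    simp [h.integral_areaDensity] at horient
  have hsq : ∀ t ∈ Icc (0 : ℝ) 1, α t ^ 2 = c ^ 2 := fun t ht => by
    have h1 := derivWithin_fst_eq (hder t ht) (hud t ht)
    have h2 := derivWithin_snd_eq (hder t ht) (hud t ht)
    rw [← hc t ht, h1, h2, Real.sq_sqrt (by positivity), hdα t ht, Prod.smul_fst, Prod.smul_snd,
      smul_eq_mul, smul_eq_mul, mul_pow, mul_pow, ← mul_add,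
      unitTangent_sq_add_sq (hreg _ (hfφ t ht)), mul_one]
  suffices ∃ b, ∀ t ∈ Icc (0 : ℝ) 1, α t = b by
    obtain ⟨b, hb⟩ := this
    exact ⟨b, hne b (hlevel b hb), hlevel b hb⟩
  by_cases hc0 : c = 0
  · exact ⟨0, fun t ht => by simpa [hc0] using hsq t ht⟩
  · rcases isPreconnected_Icc.eq_or_eq_neg_of_sq_eq hαcont continuousOn_const hsq
      (fun _ => hc0) with h | h
    · exact ⟨c, h⟩
    · exact ⟨-c, h⟩

lemma TendstoContDiffOn.tendsto_areaDensity (h : TendstoContDiffOn 1 F f l univ) {p : ℝ × ℝ}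
    (hp : fderiv ℝ f p ≠ 0) :
    Tendsto (fun q : ι × (ℝ × ℝ) => areaDensity (F q.1) q.2) (l ×ˢ 𝓝 p)
      (𝓝 (areaDensity f p)) := by
  have h1 : Tendsto (fun q : ι × (ℝ × ℝ) => q.2) (l ×ˢ 𝓝 p) (𝓝 p) := tendsto_snd
  have h2 := h.tendsto_unitTangent hp
  exact (h1.fst_nhds.mul h2.snd_nhds).sub (h1.snd_nhds.mul h2.fst_nhds)

/-- Positively oriented level curves do not converge to a reversed positively oriented curve. -/
lemma not_tendsto_speed_neg [l.NeBot] (h : TendstoContDiffOn 1 F f l univ)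
    (hreg : ∀ v, f v = 1 → fderiv ℝ f v ≠ 0) {φ : ι → ℝ → ℝ × ℝ} {b : ι → ℝ}
    (hψ : IsLevelCurve f a ψ 1) (hψc : ψ 0 = ψ 1)
    (hφ : ∀ n, IsLevelCurve (F n) (b n) (φ n) 1) (h0 : Tendsto (fun n => φ n 0) l (𝓝 (ψ 0)))
    (hψpos : 0 < ∫ t in (0 : ℝ)..1, a * areaDensity f (ψ t))
    (hφpos : ∀ n, 0 < ∫ t in (0 : ℝ)..1, b n * areaDensity (F n) (φ n t)) :
    ¬ Tendsto b l (𝓝 (-a)) := by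
  intro hb
  set A := ∫ t in (0 : ℝ)..1, a * areaDensity f (ψ t) with hA
  have hrev := hψ.reverse
  have hlim := tendsto_levelCurve h hreg hb (.of_forall hφ) hrev (by simpa [← hψc] using h0)
  have hdens : ∀ t ∈ Icc (0 : ℝ) 1, Tendsto
      (fun q : ι × ℝ => b q.1 * areaDensity (F q.1) (φ q.1 q.2)) (l ×ˢ 𝓝[Icc 0 1] t)
      (𝓝 (-a * areaDensity f (ψ (1 - t)))) := fun t ht =>
    (hb.comp tendsto_fst).mul ((h.tendsto_areaDensity (hreg _ (hrev t ht).1)).comp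
      (tendsto_fst.prodMk (hlim t ht)))
  have hcont : ContinuousOn (fun t => -a * areaDensity f (ψ (1 - t))) (Icc 0 1) := by
    have hf : ContDiff ℝ 1 f := contDiffOn_univ.1 (by simpa using h.2.1)
    have hu : ContinuousOn (fun t => unitTangent (fderiv ℝ f (ψ (1 - t)))) (Icc 0 1) :=
      (contDiffOn_unitTangent (n := 0)).continuousOn.comp
        ((hf.continuous_fderiv one_ne_zero).comp_continuousOn hrev.continuousOn)
        fun t ht => hreg _ (hrev t ht).1
    exact continuousOn_const.mul ((hrev.continuousOn.fst.mul hu.snd).sub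
      (hrev.continuousOn.snd.mul hu.fst))
  have hunif := (tendstoLocallyUniformlyOn_iff_tendstoUniformlyOn_of_compact isCompact_Icc).1
    ((tendstoLocallyUniformlyOn_iff_tendsto_prod
      (F := fun n t => b n * areaDensity (F n) (φ n t)) hcont).2 hdens)
  obtain ⟨n, hn⟩ := (Metric.tendstoUniformlyOn_iff.1 hunif (A / 2) (half_pos hψpos)).exists
  have hg_int : IntervalIntegrable (fun t => -a * areaDensity f (ψ (1 - t)))
      MeasureTheory.volume 0 1 := by
    refine ContinuousOn.intervalIntegrable ?_
    rwa [uIcc_of_le zero_le_one]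
  have hle : ∫ t in (0 : ℝ)..1, b n * areaDensity (F n) (φ n t) ≤
      ∫ t in (0 : ℝ)..1, (-a * areaDensity f (ψ (1 - t)) + A / 2) := by
    refine integral_mono_on zero_le_one (intervalIntegrable_of_integral_ne_zero (hφpos n).ne')
      (hg_int.add intervalIntegrable_const) fun t ht => ?_
    have := hn t ht
    rw [Real.dist_eq] at this
    linarith [(abs_lt.1 this).1]
  have hrevint : ∫ t in (0 : ℝ)..1, -a * areaDensity f (ψ (1 - t)) = -A := by
    rw [integral_comp_sub_left (fun t => -a * areaDensity f (ψ t)) 1]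
    simp [hA]
  rw [integral_add hg_int intervalIntegrable_const, hrevint] at hle
  simp only [integral_const, sub_zero, smul_eq_mul, one_mul] at hle
  linarith [hφpos n]

/-- The signed speeds of positively oriented simple closed level curves converge. -/
lemma tendsto_speed (h : TendstoContDiffOn 1 F f l univ)
    (hreg : ∀ v, f v = 1 → fderiv ℝ f v ≠ 0) {φ : ι → ℝ → ℝ × ℝ} {b : ι → ℝ}
    (ha : a ≠ 0) (hψ : IsLevelCurve f a ψ 1) (hψc : ψ 0 = ψ 1) (hψinj : InjOn ψ (Ico 0 1))
    (hb : ∀ n, b n ≠ 0) (hφ : ∀ n, IsLevelCurve (F n) (b n) (φ n) 1)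
    (hφc : ∀ n, φ n 0 = φ n 1) (hφinj : ∀ n, InjOn (φ n) (Ico 0 1))
    (h0 : Tendsto (fun n => φ n 0) l (𝓝 (ψ 0)))
    (hψpos : 0 < ∫ t in (0 : ℝ)..1, a * areaDensity f (ψ t))
    (hφpos : ∀ n, 0 < ∫ t in (0 : ℝ)..1, b n * areaDensity (F n) (φ n t)) :
    Tendsto b l (𝓝 a) := by
  rw [tendsto_iff_ultrafilter]
  intro U hU
  replace h := h.mono_filter hU
  replace h0 := h0.mono_left hU
  have hbound : ∀ ε : ℝ, 0 < ε → ε < 1 / 2 →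
      ∀ᶠ n in (U : Filter ι), b n / a ∈ Icc (-(1 + 2 * ε)) (1 + 2 * ε) := by
    intro ε hε hε1
    have h1 := Ultrafilter.eventually_not.2
      (not_eventually_one_add_le_div h hreg hε hε1 ha hψ hψc hφ hφinj h0)
    have h2 := Ultrafilter.eventually_not.2
      (not_eventually_one_add_le_div h hreg hε hε1 (neg_ne_zero.2 ha) hψ.reverse
        (by simp [hψc]) hφ hφinj (by simpa [← hψc] using h0))
    filter_upwards [h1, h2] with n hn1 hn2
    rw [div_neg] at hn2
    exact ⟨by linarith, by linarith⟩
  obtain ⟨r, -, hr⟩ := isCompact_Icc.ultrafilter_le_nhds' (U.map fun n => b n / a)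
    (hbound (1 / 4) (by norm_num) (by norm_num))
  replace hr : Tendsto (fun n => b n / a) U (𝓝 r) := hr
  have hr1 : r ∈ Icc (-1 : ℝ) 1 := by
    have h1 : ∀ ε : ℝ, 0 < ε → ε < 1 / 2 → r ∈ Icc (-(1 + 2 * ε)) (1 + 2 * ε) := fun ε hε hε1 =>
      isClosed_Icc.mem_of_tendsto hr (hbound ε hε hε1)
    constructor
    · by_contra! hlt
      have hm := lt_min (by linarith : 0 < (-1 - r) / 4) (by norm_num : (0 : ℝ) < 1 / 4)
      linarith [(h1 _ hm ((min_le_right _ _).trans_lt (by norm_num))).1,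
        min_le_left ((-1 - r) / 4) (1 / 4)]
    · by_contra! hlt
      have hm := lt_min (by linarith : 0 < (r - 1) / 4) (by norm_num : (0 : ℝ) < 1 / 4)
      linarith [(h1 _ hm ((min_le_right _ _).trans_lt (by norm_num))).2,
        min_le_left ((r - 1) / 4) (1 / 4)]
  have hbr : Tendsto b U (𝓝 (a * r)) := by
    refine (hr.const_mul a).congr fun n => ?_
    field_simp
  have hr0 : r ≠ 0 := by
    rintro rfl
    exact not_tendsto_speed_zero h (hreg _ (hψ 0 (by simp)).1) hφ hb hφc h0 (by simpa using hbr)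
  have hzero : (0 : ℝ) ∈ Ico (0 : ℝ) 1 := by simp
  have hend : ∀ d : ℝ, ψ d = ψ 0 → (∀ t ∈ Icc (0 : ℝ) 1, r * t + d ∈ Icc (0 : ℝ) 1) →
      ψ (r + d) = ψ 0 := by
    intro d hd hrd
    have hlim := tendsto_levelCurve h hreg hbr (.of_forall hφ) (hψ.comp_affine r d 1 hrd)
      (by simpa [hd] using h0)
    have h1 : Tendsto (fun n => φ n 1) U (𝓝 (ψ (r * 1 + d))) :=
      tendsto_apply_of_tendsto_prod (hlim 1 (by simp)) (by simp)
    rw [mul_one] at h1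
    exact tendsto_nhds_unique h1 (h0.congr hφc)
  rcases le_or_gt 0 r with hrs | hrs
  · have h1 := hend 0 rfl fun t ht => by
      rw [add_zero]
      exact ⟨mul_nonneg hrs ht.1, mul_le_one₀ hr1.2 ht.1 ht.2⟩
    rw [add_zero] at h1
    rcases hr1.2.eq_or_lt with rfl | hlt
    · simpa using hbr
    · exact absurd (hψinj ⟨hrs, hlt⟩ hzero h1) hr0
  · have h1 := hend 1 hψc.symm fun t ht => by
      constructor <;> nlinarith [ht.1, ht.2, hr1.1]
    have h2 := hψinj ⟨by linarith [hr1.1], by linarith⟩ hzero h1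
    obtain rfl : r = -1 := by linarith
    exact absurd (by simpa using hbr)
      (not_tendsto_speed_neg h hreg hψ hψc hφ h0 hψpos hφpos)

/-- Convergence of level curves propagates to their derivatives. -/
lemma tendstoContDiffOn_levelCurve {k : ℕ} (h : TendstoContDiffOn (k + 1) F f l univ)
    (hreg : ∀ v, f v = 1 → fderiv ℝ f v ≠ 0)
    (hregF : ∀ n v, F n v = 1 → fderiv ℝ (F n) v ≠ 0) {φ : ι → ℝ → ℝ × ℝ} {b : ι → ℝ}
    (hb : Tendsto b l (𝓝 a)) (hψ : IsLevelCurve f a ψ S)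
    (hφ : ∀ n, IsLevelCurve (F n) (b n) (φ n) S)
    (h0 : Tendsto (fun n => φ n 0) l (𝓝 (ψ 0))) (hS : 0 < S) :
    TendstoContDiffOn (k + 1) φ ψ l (Icc 0 S) := by
  have hud : UniqueDiffOn ℝ (Icc 0 S) := uniqueDiffOn_Icc hS
  have hlim := tendsto_levelCurve (h.mono (by lia)) hreg hb (.of_forall hφ) hψ h0
  suffices ∀ j ≤ k + 1, TendstoContDiffOn j φ ψ l (Icc 0 S) from this _ le_rfl
  intro j
  induction j with
  | zero =>
    exact fun _ => tendstoContDiffOn_zero_iff.2 ⟨fun n => (hφ n).continuousOn, hψ.continuousOn, hlim⟩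
  | succ j ih =>
    intro hj
    refine (tendstoContDiffOn_succ_iff hud).2 ⟨fun n t ht =>
      (hφ n t ht).2.differentiableWithinAt, fun t ht => (hψ t ht).2.differentiableWithinAt,
      hlim, ?_⟩
    have hfderiv : TendstoContDiffOn j (fun n => fderiv ℝ (F n)) (fderiv ℝ f) l univ := by
      simpa only [fderivWithin_univ] using
        ((tendstoContDiffOn_succ_iff uniqueDiffOn_univ).1 (h.mono hj)).2.2.2
    have hgrad := hfderiv.comp hud uniqueDiffOn_univ (ih (by lia)) (fun n => mapsTo_univ _ _)
      (mapsTo_univ _ _)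
    have hpair := (tendstoContDiffOn_of_tendsto (j := j) hb hud).prodMk hud hgrad
    set t : Set (ℝ × (ℝ × ℝ →L[ℝ] ℝ)) := {p | p.2 ≠ 0} with ht
    have htopen : IsOpen t := isOpen_ne.preimage continuous_snd
    have hvel : ContDiffOn ℝ j (fun p : ℝ × (ℝ × ℝ →L[ℝ] ℝ) =>
        ContinuousLinearMap.toSpanSingleton ℝ (p.1 • unitTangent p.2)) t :=
      (ContinuousLinearMap.toSpanSingletonCLE (𝕜 := ℝ) (E := ℝ × ℝ)).contDiff.comp_contDiffOn
        (contDiff_fst.contDiffOn.smul (contDiffOn_unitTangent.comp contDiff_snd.contDiffOn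
          fun p hp => hp))
    have hfd : ∀ {G : ℝ × ℝ → ℝ} {c : ℝ} {χ : ℝ → ℝ × ℝ}, IsLevelCurve G c χ S →
        EqOn (fderivWithin ℝ χ (Icc 0 S)) (fun s => ContinuousLinearMap.toSpanSingleton ℝ
          (c • unitTangent (fderiv ℝ G (χ s)))) (Icc 0 S) := fun hχ s hs =>
      (hχ s hs).2.hasFDerivWithinAt.fderivWithin (hud s hs)
    exact ((tendstoContDiffOn_const hvel htopen.uniqueDiffOn).comp hud htopen.uniqueDiffOn hpair
      (fun n s hs => hregF n _ (hφ n s hs).1) fun s hs => hreg _ (hψ s hs).1).congr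
      (fun n => hfd (hφ n)) (hfd hψ)

end LevelCurve

/-- Lemma 4.3 of the paper. Let `fₙ, f : ℝ² → ℝ` be proper `C^k`
functions (`k ≥ 1`) with `fₙ → f` in `C^k_loc`, having `1` as a regular value and
connected level sets `{fₙ = 1}`, `{f = 1}`. Let `γₙ, γ : [0,1] → ℝ²` be `C^k` closed
constant-Euclidean-speed curves, injective on `[0,1)`, positively oriented, parametrizing
`{fₙ = 1}` and `{f = 1}`, with `γₙ(0) → γ(0)` and `γₙ(1) → γ(1)`. Then `γₙ → γ` in
`C^k([0,1])`. -/
theorem level_curves_converge (k : ℕ) (hk : 1 ≤ k)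
    (fseq : ℕ → ℝ × ℝ → ℝ) (f : ℝ × ℝ → ℝ)
    -- smoothness
    (hf_smooth : ContDiff ℝ k f) (hfseq_smooth : ∀ m : ℕ, ContDiff ℝ k (fseq m))
    -- properness
    (hf_proper : ∀ K : Set ℝ, IsCompact K → IsCompact (f ⁻¹' K))
    (hfseq_proper : ∀ m : ℕ, ∀ K : Set ℝ, IsCompact K → IsCompact (fseq m ⁻¹' K))
    -- C^k_loc convergence
    (hconv : ∀ K : Set (ℝ × ℝ), IsCompact K → ∀ i : ℕ, i ≤ k →
      TendstoUniformlyOn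
        (fun (m : ℕ) (x : ℝ × ℝ) => iteratedFDeriv ℝ i (fseq m) x)
        (iteratedFDeriv ℝ i f) atTop K)
    -- 1 is a regular value
    (hf_reg : ∀ v : ℝ × ℝ, f v = 1 → fderiv ℝ f v ≠ 0)
    (hfseq_reg : ∀ m : ℕ, ∀ v : ℝ × ℝ, fseq m v = 1 → fderiv ℝ (fseq m) v ≠ 0)
    -- connected level sets
    (hf_conn : IsConnected {v : ℝ × ℝ | f v = 1})
    (hfseq_conn : ∀ m : ℕ, IsConnected {v : ℝ × ℝ | fseq m v = 1})
    -- the curves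
    (γseq : ℕ → ℝ → ℝ × ℝ) (γ : ℝ → ℝ × ℝ)
    (hγ_smooth : ContDiffOn ℝ k γ (Icc 0 1))
    (hγseq_smooth : ∀ m : ℕ, ContDiffOn ℝ k (γseq m) (Icc 0 1))
    -- closed curves
    (hγ_closed : γ 0 = γ 1) (hγseq_closed : ∀ m : ℕ, γseq m 0 = γseq m 1)
    -- injective on [0,1)
    (hγ_inj : InjOn γ (Ico 0 1)) (hγseq_inj : ∀ m : ℕ, InjOn (γseq m) (Ico 0 1))
    -- constant Euclidean speed
    (hγ_speed : ∃ c : ℝ, ∀ t ∈ Icc (0 : ℝ) 1,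
      Real.sqrt ((derivWithin (fun s => (γ s).1) (Icc 0 1) t) ^ 2 +
        (derivWithin (fun s => (γ s).2) (Icc 0 1) t) ^ 2) = c)
    (hγseq_speed : ∀ m : ℕ, ∃ c : ℝ, ∀ t ∈ Icc (0 : ℝ) 1,
      Real.sqrt ((derivWithin (fun s => (γseq m s).1) (Icc 0 1) t) ^ 2 +
        (derivWithin (fun s => (γseq m s).2) (Icc 0 1) t) ^ 2) = c)
    -- positive orientation
    (hγ_orient : 0 < ∫ t in (0 : ℝ)..1,
      ((γ t).1 * derivWithin (fun s => (γ s).2) (Icc 0 1) t -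
        (γ t).2 * derivWithin (fun s => (γ s).1) (Icc 0 1) t))
    (hγseq_orient : ∀ m : ℕ, 0 < ∫ t in (0 : ℝ)..1,
      ((γseq m t).1 * derivWithin (fun s => (γseq m s).2) (Icc 0 1) t -
        (γseq m t).2 * derivWithin (fun s => (γseq m s).1) (Icc 0 1) t))
    -- images are the level sets
    (hγ_image : γ '' Icc 0 1 = {v : ℝ × ℝ | f v = 1})
    (hγseq_image : ∀ m : ℕ, γseq m '' Icc 0 1 = {v : ℝ × ℝ | fseq m v = 1})
    -- convergence of endpoints
    (hends0 : Tendsto (fun m => γseq m 0) atTop (nhds (γ 0)))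
    (hends1 : Tendsto (fun m => γseq m 1) atTop (nhds (γ 1))) :
    ∀ i : ℕ, i ≤ k →
      TendstoUniformlyOn
        (fun (m : ℕ) (t : ℝ) => iteratedDerivWithin i (γseq m) (Icc 0 1) t)
        (iteratedDerivWithin i γ (Icc 0 1)) atTop (Icc 0 1) := by
  have hk' : k - 1 + 1 = k := by lia
  have hk1 : ((1 : ℕ) : ℕ∞ω) ≤ k := mod_cast hk
  have h : TendstoContDiffOn k fseq f atTop univ :=
    tendstoContDiffOn_univ hfseq_smooth hf_smooth hconv
  have hcurve := exists_isLevelCurve (hf_smooth.of_le hk1) hf_reg (hγ_smooth.of_le hk1)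
    (fun t ht => hγ_image.subset (mem_image_of_mem γ ht)) hγ_speed hγ_orient
  obtain ⟨a, ha, hγ⟩ := hcurve
  have hcurves := fun m => exists_isLevelCurve ((hfseq_smooth m).of_le hk1) (hfseq_reg m)
    ((hγseq_smooth m).of_le hk1)
    (fun t ht => (hγseq_image m).subset (mem_image_of_mem (γseq m) ht)) (hγseq_speed m)
    (hγseq_orient m)
  choose b hb hγseq using hcurves
  have hspeed : Tendsto b atTop (𝓝 a) :=
    tendsto_speed (h.mono hk) hf_reg ha hγ hγ_closed hγ_inj hb hγseq hγseq_closed hγseq_inj hends0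
      (hγ.integral_areaDensity ▸ hγ_orient)
      fun m => (hγseq m).integral_areaDensity ▸ hγseq_orient m
  have hC := tendstoContDiffOn_levelCurve (k := k - 1) (hk'.symm ▸ h) hf_reg hfseq_reg hspeed hγ
    hγseq hends0 zero_lt_one
  rw [hk'] at hC
  exact fun i hi => hC.tendstoUniformlyOn_iteratedDerivWithin hi isCompact_Icc
    (uniqueDiffOn_Icc zero_lt_one)
end
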